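/- arXiv:2010.15650 — 7 statements merged into one kernel-verified Lean document; each statement's English description precedes it below -/
import Mathlib

section
/- Let G be a finite connected simple graph and c₀ an initial configuration from which chip-firing terminates. The map k^j ↦ c(k^j) is an order isomorphism from the move poset onto the subposet of join-irreducible elements of the configuration poset (the configurations that cover exactly one element, equivalently the reachable configurations in which exactly one vertex is ready to fire). In particular, the join-irreducibles of the configuration poset form the move poset. -/
/-!  Chip-firing on a finite simple graph. -/

/-- One chip-firing move at vertex `k`: `k` loses `deg k` chips and each of its
neighbors gains one chip. -/
def gfire {V : Type*} [Fintype V] [DecidableEq V] (G : SimpleGraph V) [DecidableRel G.Adj]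
    (c : V → ℕ) (k : V) : V → ℕ :=
  fun v => if v = k then c k - G.degree k else if G.Adj k v then c v + 1 else c v

/-- Apply a list of firing moves in order. -/
def gapply {V : Type*} [Fintype V] [DecidableEq V] (G : SimpleGraph V) [DecidableRel G.Adj]
    (c : V → ℕ) : List V → (V → ℕ)
  | [] => c
  | k :: s => gapply G (gfire G c k) s

/-- The list of vertices `s` is a legal firing sequence from `c`: every fired vertex
has at least as many chips as its degree at the moment it is fired. -/
def GLegal {V : Type*} [Fintype V] [DecidableEq V] (G : SimpleGraph V) [DecidableRel G.Adj]
    (c : V → ℕ) : List V → Prop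
  | [] => True
  | k :: s => G.degree k ≤ c k ∧ GLegal G (gfire G c k) s

/-- `c₂` is reachable from `c₁` by a sequence of firing moves. -/
def GReachable {V : Type*} [Fintype V] [DecidableEq V] (G : SimpleGraph V) [DecidableRel G.Adj]
    (c₁ c₂ : V → ℕ) : Prop :=
  ∃ s, GLegal G c₁ s ∧ gapply G c₁ s = c₂

/-- Vertex `k` is ready to fire in `c`. -/
def GReady {V : Type*} [Fintype V] [DecidableEq V] (G : SimpleGraph V) [DecidableRel G.Adj]
    (c : V → ℕ) (k : V) : Prop := G.degree k ≤ c k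

/-- No vertex is ready to fire in `c`. -/
def GStable {V : Type*} [Fintype V] [DecidableEq V] (G : SimpleGraph V) [DecidableRel G.Adj]
    (c : V → ℕ) : Prop := ∀ k, c k < G.degree k

/-- Some legal firing sequence from `c₀` performs the `j'`-th firing at `k'`
strictly before the `j`-th firing at `k`: there is a legal sequence with a prefix `t`
containing exactly `j' - 1` firings at `k'` and fewer than `j` firings at `k`,
immediately followed by a firing at `k'`. -/
def GFiresBefore {V : Type*} [Fintype V] [DecidableEq V] (G : SimpleGraph V) [DecidableRel G.Adj]
    (c₀ : V → ℕ) (k' : V) (j' : ℕ) (k : V) (j : ℕ) : Prop :=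
  ∃ t u : List V, GLegal G c₀ (t ++ k' :: u) ∧ t.count k' = j' - 1 ∧ t.count k < j

/-- The move-poset order: move `p = (k, j)` (the `j`-th firing at `k`) satisfies `p ≥ q`
iff `p = q` or no legal firing sequence from `c₀` performs move `q` strictly before `p`. -/
def GMoveGE {V : Type*} [Fintype V] [DecidableEq V] (G : SimpleGraph V) [DecidableRel G.Adj]
    (c₀ : V → ℕ) (p q : V × ℕ) : Prop :=
  p = q ∨ ¬ GFiresBefore G c₀ q.1 q.2 p.1 p.2

theorem List.exists_append_cons_of_le_count {α : Type*} [DecidableEq α] (a : α) {n : ℕ} (hn : 1 ≤ n)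
    (l : List α) (h : n ≤ l.count a) : ∃ t u, l = t ++ a :: u ∧ t.count a = n - 1 := by
  induction l using List.reverseRecOn with
  | nil => simp at h; omega
  | append_singleton l b ih =>
    by_cases hl : n ≤ l.count a
    · obtain ⟨t, u, rfl, ht⟩ := ih hl
      exact ⟨t, u ++ [b], by simp, ht⟩
    · rw [List.count_append, List.count_singleton] at h
      split_ifs at h with hb
      · obtain rfl : b = a := by simpa using hb
        exact ⟨l, [], rfl, by omega⟩
      · omega

theorem List.exists_append_maximal {α : Type*} {P : List α → Prop} {B : ℕ}
    (hB : ∀ s, P s → s.length ≤ B) (s : List α) (hs : P s) :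
    ∃ u, P (s ++ u) ∧ ∀ a, ¬ P (s ++ u ++ [a]) := by
  induction h : B - s.length using Nat.strong_induction_on generalizing s with
  | _ n ih =>
    by_cases hmax : ∃ a, P (s ++ [a])
    · obtain ⟨a, ha⟩ := hmax
      have hlen := hB _ ha
      simp only [List.length_append, List.length_singleton] at hlen
      obtain ⟨u, hu, hu'⟩ := ih (B - (s ++ [a]).length) (by simp; omega) _ ha rfl
      exact ⟨a :: u, by simpa using hu, by simpa using hu'⟩
    · push Not at hmax
      exact ⟨[], by simpa using hs, by simpa using hmax⟩

section ChipFiring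

variable {V : Type*} [Fintype V] [DecidableEq V] {G : SimpleGraph V} [DecidableRel G.Adj]
  {c : V → ℕ}

theorem gapply_append (c : V → ℕ) (s t : List V) :
    gapply G c (s ++ t) = gapply G (gapply G c s) t := by
  induction s generalizing c with
  | nil => rfl
  | cons a s ih => exact ih _

theorem gLegal_append (c : V → ℕ) (s t : List V) :
    GLegal G c (s ++ t) ↔ GLegal G c s ∧ GLegal G (gapply G c s) t := by
  induction s generalizing c with
  | nil => simp [GLegal, gapply]
  | cons a s ih => simp [GLegal, gapply, ih, and_assoc]

theorem gLegal_append_singleton (c : V → ℕ) (s : List V) (a : V) :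
    GLegal G c (s ++ [a]) ↔ GLegal G c s ∧ GReady G (gapply G c s) a := by
  simp [gLegal_append, GLegal, GReady]

theorem gapply_add_degree_mul_count {s : List V} (hs : GLegal G c s) (v : V) :
    gapply G c s v + G.degree v * s.count v = c v + ∑ u ∈ G.neighborFinset v, s.count u := by
  induction s generalizing c with
  | nil => simp [gapply]
  | cons a s ih =>
    obtain ⟨ha, hs⟩ := hs
    have h := ih hs
    have hsum : ∑ u ∈ G.neighborFinset v, (a :: s).count u =
        ∑ u ∈ G.neighborFinset v, s.count u + if G.Adj a v then 1 else 0 := by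
      simp [List.count_cons, Finset.sum_add_distrib, G.adj_comm]
    rw [hsum, List.count_cons]
    simp only [gapply, gfire] at h ⊢
    by_cases hav : v = a
    · subst hav
      simp only [if_true, SimpleGraph.irrefl, if_false, beq_self_eq_true, mul_add] at h ⊢
      omega
    · have hav' : ¬ a = v := fun h => hav h.symm
      simp only [hav, hav', if_false, beq_iff_eq, add_zero] at h ⊢
      split_ifs at h ⊢ <;> omega

theorem gapply_eq_of_count_eq {s t : List V} (hs : GLegal G c s) (ht : GLegal G c t)
    (h : ∀ v, s.count v = t.count v) : gapply G c s = gapply G c t := by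
  funext v
  have h₁ := gapply_add_degree_mul_count hs v
  have h₂ := gapply_add_degree_mul_count ht v
  simp only [h] at h₁
  omega

theorem GReady.of_count_le {s t : List V} (hs : GLegal G c s) (ht : GLegal G c t) {v : V}
    (hle : ∀ w, t.count w ≤ s.count w) (hv : s.count v = t.count v)
    (hr : GReady G (gapply G c t) v) : GReady G (gapply G c s) v := by
  have h₁ := gapply_add_degree_mul_count hs v
  have h₂ := gapply_add_degree_mul_count ht v
  have h₃ : ∑ u ∈ G.neighborFinset v, t.count u ≤ ∑ u ∈ G.neighborFinset v, s.count u :=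
    Finset.sum_le_sum fun u _ => hle u
  rw [hv] at h₁
  unfold GReady at *
  omega

theorem exists_gReady_of_count_lt {s t : List V} (hs : GLegal G c s) (ht : GLegal G c t)
    (h : ∃ w, s.count w < t.count w) :
    ∃ v, GReady G (gapply G c s) v ∧ s.count v < t.count v := by
  induction t using List.reverseRecOn with
  | nil => simp at h
  | append_singleton t a ih =>
    obtain ⟨ht, ha⟩ := (gLegal_append_singleton c t a).1 ht
    by_cases h' : ∃ w, s.count w < t.count w
    · obtain ⟨v, hv, hlt⟩ := ih ht h'
      exact ⟨v, hv, hlt.trans_le (by simp)⟩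
    · push Not at h'
      obtain ⟨w, hw⟩ := h
      have hle := h' w
      rw [List.count_append, List.count_singleton] at hw
      split_ifs at hw with haw
      · obtain rfl : a = w := by simpa using haw
        exact ⟨a, ha.of_count_le hs ht h' (by omega), by simp; omega⟩
      · omega

theorem count_le_of_forall_gReady {s t : List V} (hs : GLegal G c s) (ht : GLegal G c t)
    (h : ∀ v, GReady G (gapply G c s) v → t.count v ≤ s.count v) (v : V) :
    t.count v ≤ s.count v := by
  by_contra! hlt
  obtain ⟨w, hw, hlt⟩ := exists_gReady_of_count_lt hs ht ⟨v, hlt⟩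
  exact (h w hw).not_gt hlt

theorem gReachable_of_count_le {s t : List V} (hs : GLegal G c s) (ht : GLegal G c t)
    (h : ∀ v, s.count v ≤ t.count v) : GReachable G (gapply G c s) (gapply G c t) := by
  obtain ⟨u, ⟨hu, hle⟩, hmax⟩ := List.exists_append_maximal
    (P := fun l => GLegal G c l ∧ ∀ v, l.count v ≤ t.count v) (B := t.length)
    (fun l hl => (List.subperm_ext_iff.2 fun v _ => hl.2 v).length_le) s ⟨hs, h⟩
  refine ⟨u, ((gLegal_append c s u).1 hu).2, ?_⟩
  rw [← gapply_append]
  refine gapply_eq_of_count_eq hu ht fun v => (hle v).antisymm ?_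
  by_contra! hlt
  obtain ⟨w, hw, hlt⟩ := exists_gReady_of_count_lt hu ht ⟨v, hlt⟩
  refine hmax w ⟨(gLegal_append_singleton c _ w).2 ⟨hu, hw⟩, fun x => ?_⟩
  rw [List.count_append, List.count_singleton]
  split_ifs with hwx
  · obtain rfl : w = x := by simpa using hwx
    exact hlt
  · exact hle x

theorem length_le_of_gStable {S s : List V} (hS : GLegal G c S) (hst : GStable G (gapply G c S))
    (hs : GLegal G c s) : s.length ≤ S.length :=
  (List.subperm_ext_iff.2 fun v _ => count_le_of_forall_gReady hS hs
    (fun w hw => absurd hw (hst w).not_ge) v).length_le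

theorem exists_append_gStable (hterm : ∃ s, GLegal G c s ∧ GStable G (gapply G c s))
    {s : List V} (hs : GLegal G c s) :
    ∃ u, GLegal G c (s ++ u) ∧ GStable G (gapply G c (s ++ u)) := by
  obtain ⟨S, hS, hst⟩ := hterm
  obtain ⟨u, hu, hmax⟩ :=
    List.exists_append_maximal (fun _ hl => length_le_of_gStable hS hst hl) s hs
  refine ⟨u, hu, fun v => ?_⟩
  by_contra! hv
  exact hmax v ((gLegal_append_singleton c _ v).2 ⟨hu, hv⟩)

variable {N : V → ℕ}

theorem count_eq_of_gapply_eq (hterm : ∃ s, GLegal G c s ∧ GStable G (gapply G c s))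
    (hN : ∀ s, GLegal G c s → GStable G (gapply G c s) → ∀ k, s.count k = N k)
    {s t : List V} (hs : GLegal G c s) (ht : GLegal G c t)
    (h : gapply G c s = gapply G c t) (v : V) : s.count v = t.count v := by
  obtain ⟨u, hu, hst⟩ := exists_append_gStable hterm hs
  have h₁ := hN _ hu hst v
  rw [gapply_append, h, ← gapply_append] at hst
  rw [gLegal_append, h] at hu
  have h₂ := hN _ ((gLegal_append c t u).2 ⟨ht, hu.2⟩) hst v
  rw [List.count_append] at h₁ h₂
  omega

theorem count_le_of_gLegal (hterm : ∃ s, GLegal G c s ∧ GStable G (gapply G c s))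
    (hN : ∀ s, GLegal G c s → GStable G (gapply G c s) → ∀ k, s.count k = N k)
    {s : List V} (hs : GLegal G c s) (v : V) : s.count v ≤ N v := by
  obtain ⟨u, hu, hst⟩ := exists_append_gStable hterm hs
  rw [← hN _ hu hst v, List.count_append]
  omega

/-- Firing every vertex as long as possible, while withholding the `j`-th firing at `k`, leads to
a configuration in which exactly `k` is ready to fire. -/
theorem exists_gLegal_unique_gReady (hterm : ∃ s, GLegal G c s ∧ GStable G (gapply G c s))
    (hN : ∀ s, GLegal G c s → GStable G (gapply G c s) → ∀ k, s.count k = N k)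
    {k : V} {j : ℕ} (hj : 1 ≤ j) (hjN : j ≤ N k) :
    ∃ s, GLegal G c s ∧ s.count k = j - 1 ∧ ∀ v, GReady G (gapply G c s) v ↔ v = k := by
  obtain ⟨S, hS, hst⟩ := id hterm
  obtain ⟨s, ⟨hs, hlt⟩, hmax⟩ := List.exists_append_maximal
    (P := fun l => GLegal G c l ∧ l.count k < j)
    (fun _ hl => length_le_of_gStable hS hst hl.1) [] ⟨trivial, hj⟩
  simp only [List.nil_append] at hs hlt hmax
  have hready : ∀ v, GReady G (gapply G c s) v → v = k ∧ s.count k = j - 1 := by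
    intro v hv
    have h : ¬ (s ++ [v]).count k < j := fun h =>
      hmax v ⟨(gLegal_append_singleton c _ v).2 ⟨hs, hv⟩, h⟩
    rw [List.count_append, List.count_singleton] at h
    split_ifs at h with hvk
    · exact ⟨by simpa using hvk, by omega⟩
    · omega
  obtain ⟨v, hv⟩ : ∃ v, GReady G (gapply G c s) v := by
    by_contra! hno
    have := hN s hs (fun v => not_le.1 (hno v)) k
    omega
  obtain ⟨rfl, hcount⟩ := hready v hv
  exact ⟨s, hs, hcount, fun w => ⟨fun hw => (hready w hw).1, fun hw => hw ▸ hv⟩⟩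

theorem gMoveGE_iff_count_le {s s' : List V} {k k' : V} {j j' : ℕ} (hj : 1 ≤ j) (hj' : 1 ≤ j')
    (hs : GLegal G c s) (hs' : GLegal G c s') (hsk : s.count k = j - 1)
    (hsk' : s'.count k' = j' - 1) (hr : ∀ v, GReady G (gapply G c s) v ↔ v = k)
    (hr' : ∀ v, GReady G (gapply G c s') v ↔ v = k') :
    GMoveGE G c (k, j) (k', j') ↔ ∀ v, s.count v ≤ s'.count v := by
  constructor
  · intro h
    refine count_le_of_forall_gReady hs' hs fun v hv => ?_
    obtain rfl := (hr' v).1 hv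
    rcases h with h | h
    · obtain ⟨rfl, rfl⟩ := Prod.mk.inj h
      omega
    · by_contra! hlt
      obtain ⟨t, u, rfl, ht⟩ := List.exists_append_cons_of_le_count v hj' s (by omega)
      refine h ⟨t, u, hs, ht, ?_⟩
      rw [List.count_append] at hsk
      dsimp only
      omega
  · intro h
    by_contra hne
    simp only [GMoveGE, not_or, not_not] at hne
    obtain ⟨hne, t, u, htu, htk', htk⟩ := hne
    by_cases hk : k' = k
    · subst hk
      have := h k'
      exact hne (by rw [Prod.mk.injEq]; exact ⟨rfl, by omega⟩)
    · have ht : GLegal G c (t ++ [k']) := by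
        rw [gLegal_append] at htu ⊢
        exact ⟨htu.1, htu.2.1, trivial⟩
      have hle := count_le_of_forall_gReady hs ht (fun v hv => by
        obtain rfl := (hr v).1 hv
        rw [List.count_append, List.count_singleton, if_neg (by simpa using hk)]
        omega) k'
      have := h k'
      simp at hle
      omega

end ChipFiring

/-- The map `k^j ↦ c(k^j)` is an order isomorphism from the move poset
onto the subposet of join-irreducible elements of the configuration poset (the reachable
configurations in which exactly one vertex is ready to fire).  Here the configuration
poset is ordered by `c ≥ c'` iff `c'` is reachable from `c`, and the move poset by
`p ≥ q` iff no firing sequence from `c₀` performs `q` strictly before `p`.  The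
bijection `φ` sends the move `(k, j)` to the unique reachable configuration in which
the only vertex ready to fire is `k` and exactly `j - 1` firings at `k` have occurred
in reaching it, and it preserves and reflects the order. -/
theorem move_poset_is_join_irreducibles
    {V : Type*} [Fintype V] [DecidableEq V] (G : SimpleGraph V) [DecidableRel G.Adj]
    (hG : G.Connected) (c₀ : V → ℕ)
    (hterm : ∃ s, GLegal G c₀ s ∧ GStable G (gapply G c₀ s))
    (N : V → ℕ)
    (hN : ∀ s, GLegal G c₀ s → GStable G (gapply G c₀ s) → ∀ k, s.count k = N k) :
    ∃ φ : {p : V × ℕ // 1 ≤ p.2 ∧ p.2 ≤ N p.1} ≃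
          {c : V → ℕ // GReachable G c₀ c ∧ ∃! k, GReady G c k},
      (∀ m : {p : V × ℕ // 1 ≤ p.2 ∧ p.2 ≤ N p.1},
        ∃ s : List V, GLegal G c₀ s ∧ gapply G c₀ s = (φ m).1 ∧
          s.count m.1.1 = m.1.2 - 1 ∧ (∀ v, GReady G (φ m).1 v ↔ v = m.1.1)) ∧
      (∀ m m' : {p : V × ℕ // 1 ≤ p.2 ∧ p.2 ≤ N p.1},
        GMoveGE G c₀ m.1 m'.1 ↔ GReachable G (φ m).1 (φ m').1) := by
  choose s hs hsk hr using fun m : {p : V × ℕ // 1 ≤ p.2 ∧ p.2 ≤ N p.1} =>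
    exists_gLegal_unique_gReady hterm hN m.2.1 m.2.2
  let f : {p : V × ℕ // 1 ≤ p.2 ∧ p.2 ≤ N p.1} →
      {c : V → ℕ // GReachable G c₀ c ∧ ∃! k, GReady G c k} := fun m =>
    ⟨gapply G c₀ (s m), ⟨s m, hs m, rfl⟩, m.1.1, (hr m m.1.1).2 rfl, fun v hv => (hr m v).1 hv⟩
  have hf : Function.Bijective f := by
    constructor
    · intro m m' h
      have h : gapply G c₀ (s m) = gapply G c₀ (s m') := congrArg Subtype.val h
      have hk : m.1.1 = m'.1.1 := (hr m' _).1 (h ▸ (hr m _).2 rfl)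
      have hcount := count_eq_of_gapply_eq hterm hN (hs m) (hs m') h m.1.1
      have hsk' := hsk m'
      rw [← hk, ← hcount, hsk m] at hsk'
      have h₁ := m.2.1
      have h₂ := m'.2.1
      exact Subtype.ext (Prod.ext hk (by omega))
    · rintro ⟨_, ⟨t, ht, rfl⟩, k, hk, huniq⟩
      have hle := count_le_of_gLegal hterm hN ((gLegal_append_singleton c₀ t k).2 ⟨ht, hk⟩) k
      simp only [List.count_append, List.count_singleton_self] at hle
      let m : {p : V × ℕ // 1 ≤ p.2 ∧ p.2 ≤ N p.1} := ⟨(k, t.count k + 1), by simp, hle⟩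
      have hcount : (s m).count k = t.count k := hsk m
      refine ⟨m, Subtype.ext (gapply_eq_of_count_eq (hs m) ht fun v => le_antisymm ?_ ?_)⟩
      · refine count_le_of_forall_gReady ht (hs m) (fun w hw => ?_) v
        rw [huniq w hw, hcount]
      · refine count_le_of_forall_gReady (hs m) ht (fun w hw => ?_) v
        rw [show w = k from (hr m w).1 hw, hcount]
  refine ⟨Equiv.ofBijective f hf, fun m => ⟨s m, hs m, rfl, hsk m, hr m⟩, fun m m' => ?_⟩
  refine (gMoveGE_iff_count_le m.2.1 m'.2.1 (hs m) (hs m') (hsk m) (hsk m') (hr m) (hr m')).trans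
    ⟨fun h => gReachable_of_count_le (hs m) (hs m') h, ?_⟩
  rintro ⟨u, hu, hu'⟩ v
  have hu' : gapply G (gapply G c₀ (s m)) u = gapply G c₀ (s m') := hu'
  rw [← gapply_append] at hu'
  rw [← count_eq_of_gapply_eq hterm hN ((gLegal_append c₀ _ u).2 ⟨hs m, hu⟩) (hs m') hu' v,
    List.count_append]
  omega
end

section
/- For chip-firing on the line starting from the endgame configuration c₀ with n = 2m chips, if c₁ and c₂ are configurations reachable from c₀ with mv(c₁) ⊆ mv(c₂), then c₂ is reachable from c₁ by a sequence of firing moves. -/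
/-!  Chip-firing on the line (the 1-dimensional grid ℤ). -/

/-- One chip-firing move at site `k` on the line: site `k` loses two chips and each of
its two neighbors gains one chip. -/
def lfire (c : ℤ → ℕ) (k : ℤ) : ℤ → ℕ :=
  fun i => if i = k then c k - 2 else if i = k - 1 ∨ i = k + 1 then c i + 1 else c i

/-- Apply a list of firing moves in order. -/
def lapply (c : ℤ → ℕ) : List ℤ → (ℤ → ℕ)
  | [] => c
  | k :: s => lapply (lfire c k) s

/-- The list of sites `s` is a legal firing sequence from `c`: every fired site has
at least 2 chips at the moment it is fired. -/
def LLegal (c : ℤ → ℕ) : List ℤ → Prop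
  | [] => True
  | k :: s => 2 ≤ c k ∧ LLegal (lfire c k) s

/-- `c₂` is reachable from `c₁` by a sequence of firing moves. -/
def LReachable (c₁ c₂ : ℤ → ℕ) : Prop :=
  ∃ s, LLegal c₁ s ∧ lapply c₁ s = c₂

/-- No site is ready to fire in `c`. -/
def LStable (c : ℤ → ℕ) : Prop := ∀ k, c k < 2

/-- The set `mv` of moves performed by the firing sequence `s`: the pair `(k, j)`
denotes the `j`-th firing at site `k`. -/
def Mv (s : List ℤ) : Set (ℤ × ℕ) := {p | 1 ≤ p.2 ∧ p.2 ≤ s.count p.1}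

/-- Some legal firing sequence from `c₀` performs the `j'`-th firing at `k'` strictly
before the `j`-th firing at `k`: there is a legal sequence with a prefix `t` containing
exactly `j' - 1` firings at `k'` and fewer than `j` firings at `k`, immediately followed
by a firing at `k'`. -/
def LFiresBefore (c₀ : ℤ → ℕ) (k' : ℤ) (j' : ℕ) (k : ℤ) (j : ℕ) : Prop :=
  ∃ t u : List ℤ, LLegal c₀ (t ++ k' :: u) ∧ t.count k' = j' - 1 ∧ t.count k < j

/-- The move-poset order: move `p = (k, j)` (the `j`-th firing at `k`) satisfies `p ≥ q`
iff `p = q` or no legal firing sequence from `c₀` performs move `q` strictly before `p`. -/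
def LMoveGE (c₀ : ℤ → ℕ) (p q : ℤ × ℕ) : Prop :=
  p = q ∨ ¬ LFiresBefore c₀ q.1 q.2 p.1 p.2

/-- The endgame configuration with `n = 2m` chips: two chips at the origin and one chip
at each site `i` with `1 ≤ |i| ≤ m - 1`. -/
def endgame (m : ℕ) : ℤ → ℕ :=
  fun i => if i = 0 then 2 else if |i| ≤ (m : ℤ) - 1 then 1 else 0

/-- `j` is the join (least upper bound) of `a` and `b` in the configuration poset of
configurations reachable from `c₀`, ordered by `c ≥ c'` iff `c'` is reachable from `c`. -/
def LIsJoin (c₀ a b j : ℤ → ℕ) : Prop :=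
  LReachable c₀ j ∧ LReachable j a ∧ LReachable j b ∧
    ∀ c, LReachable c₀ c → LReachable c a → LReachable c b → LReachable c j

/-- `mt` is the meet (greatest lower bound) of `a` and `b` in the configuration poset of
configurations reachable from `c₀`, ordered by `c ≥ c'` iff `c'` is reachable from `c`. -/
def LIsMeet (c₀ a b mt : ℤ → ℕ) : Prop :=
  LReachable c₀ mt ∧ LReachable a mt ∧ LReachable b mt ∧
    ∀ c, LReachable c₀ c → LReachable a c → LReachable b c → LReachable mt c

theorem lapply_append (c : ℤ → ℕ) (s t : List ℤ) :
    lapply c (s ++ t) = lapply (lapply c s) t := by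
  induction s generalizing c with
  | nil => rfl
  | cons k s ih => exact ih _

theorem lLegal_append (c : ℤ → ℕ) (s t : List ℤ) :
    LLegal c (s ++ t) ↔ LLegal c s ∧ LLegal (lapply c s) t := by
  induction s generalizing c with
  | nil => simp [LLegal, lapply]
  | cons k s ih => simp [LLegal, lapply, ih, and_assoc]

/-- The configuration after a legal firing sequence depends only on how often each site fires. -/
theorem lapply_eq_sub_add_count {c : ℤ → ℕ} {s : List ℤ} (h : LLegal c s) (i : ℤ) :
    (lapply c s i : ℤ) = c i - 2 * s.count i + s.count (i - 1) + s.count (i + 1) := by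
  induction s generalizing c with
  | nil => simp [lapply]
  | cons k s ih =>
    obtain ⟨hk, hs⟩ := h
    have key := ih hs
    simp only [lapply, List.count_cons, beq_iff_eq, key, lfire]
    split_ifs <;> subst_vars <;> push_cast <;> omega

/-- Deleting from a legal sequence `s₂`, for each site `k`, its first `s₁.count k` firings leaves
a sequence that is legal after the legal sequence `s₁`. -/
theorem LLegal.exists_residual {c : ℤ → ℕ} {s₁ : List ℤ} (h₁ : LLegal c s₁)
    (s₂ : List ℤ) (h₂ : LLegal c s₂) :
    ∃ r, LLegal c (s₁ ++ r) ∧ ∀ k, r.count k = s₂.count k - s₁.count k := by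
  induction s₂ using List.reverseRecOn with
  | nil => exact ⟨[], by simpa using h₁, by simp⟩
  | append_singleton t k ih =>
    obtain ⟨ht, hk, -⟩ := (lLegal_append _ _ _).1 h₂
    obtain ⟨r, hr, hcount⟩ := ih ht
    by_cases hle : s₁.count k ≤ t.count k
    · refine ⟨r ++ [k], ?_, fun i => ?_⟩
      · rw [← List.append_assoc, lLegal_append]
        refine ⟨hr, ?_, trivial⟩
        have e₁ := lapply_eq_sub_add_count hr k
        have e₂ := lapply_eq_sub_add_count ht k
        simp only [List.count_append, hcount] at e₁
        omega
      · have := hcount i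
        simp only [List.count_append, List.count_singleton, beq_iff_eq]
        split_ifs <;> subst_vars <;> omega
    · refine ⟨r, hr, fun i => ?_⟩
      have := hcount i
      simp only [List.count_append, List.count_singleton, beq_iff_eq]
      split_ifs <;> subst_vars <;> omega

theorem count_le_of_mv_subset {s₁ s₂ : List ℤ} (h : Mv s₁ ⊆ Mv s₂) (k : ℤ) :
    s₁.count k ≤ s₂.count k := by
  rcases Nat.eq_zero_or_pos (s₁.count k) with h0 | h0
  · omega
  · exact (h (show (k, s₁.count k) ∈ Mv s₁ from ⟨h0, le_rfl⟩)).2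

/-- For chip-firing on the line from the endgame configuration with
`n = 2m` chips, if `c₁` and `c₂` are reachable from `c₀` with `mv(c₁) ⊆ mv(c₂)`, then
`c₂` is reachable from `c₁` by a sequence of firing moves. -/
theorem endgame_reachable_of_mv_subset
    (m : ℕ) (hm : 1 ≤ m) (c₀ : ℤ → ℕ) (hc₀ : c₀ = endgame m)
    (c₁ c₂ : ℤ → ℕ) (s₁ s₂ : List ℤ)
    (hs₁ : LLegal c₀ s₁) (hc₁ : lapply c₀ s₁ = c₁)
    (hs₂ : LLegal c₀ s₂) (hc₂ : lapply c₀ s₂ = c₂)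
    (hsub : Mv s₁ ⊆ Mv s₂) :
    LReachable c₁ c₂ := by
  subst hc₁ hc₂
  obtain ⟨r, hr, hcount⟩ := hs₁.exists_residual s₂ hs₂
  refine ⟨r, ((lLegal_append _ _ _).1 hr).2, ?_⟩
  rw [← lapply_append]
  have hsum : ∀ k, (s₁ ++ r).count k = s₂.count k := fun k => by
    have := count_le_of_mv_subset hsub k
    have := hcount k
    simp only [List.count_append]
    omega
  funext i
  have e₁ := lapply_eq_sub_add_count hr i
  have e₂ := lapply_eq_sub_add_count hs₂ i
  simp only [hsum] at e₁
  omega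
end

section
/- For chip-firing on the line starting from the endgame configuration c₀ with n = 2m chips, every upward-closed subset S of the move poset satisfies S = mv(c₁) for some configuration c₁ reachable from c₀. -/
/-- The configuration after a legal firing sequence is determined by the firing counts. -/
theorem lapply_eq_count (c : ℤ → ℕ) (s : List ℤ) (hs : LLegal c s) (i : ℤ) :
    (lapply c s i : ℤ) = c i - 2 * s.count i + s.count (i - 1) + s.count (i + 1) := by
  induction s generalizing c with
  | nil => simp [lapply]
  | cons k s ih =>
    obtain ⟨h2, hs⟩ := hs
    have h := ih _ hs
    simp only [lapply, h, List.count_cons, beq_iff_eq, lfire]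
    split_ifs <;> first | omega | (subst_vars; omega)

/-- The firing counts that occur for the endgame configuration: moving away from the origin
they drop by at most one per step, and they vanish at distance `m` and beyond. -/
structure EndgameCount (m : ℕ) (x : ℤ → ℕ) : Prop where
  right : ∀ k, 0 ≤ k → x (k + 1) ≤ x k ∧ x k ≤ x (k + 1) + 1
  left : ∀ k, k ≤ 0 → x (k - 1) ≤ x k ∧ x k ≤ x (k - 1) + 1
  zero : ∀ k, (m : ℤ) ≤ |k| → x k = 0

theorem EndgameCount.of_lLegal {m : ℕ} (hm : 1 ≤ m) (s : List ℤ)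
    (hs : LLegal (endgame m) s) : EndgameCount m (fun k => s.count k) := by
  induction s using List.reverseRecOn with
  | nil => constructor <;> simp
  | append_singleton t k ih =>
    rw [lLegal_append] at hs
    obtain ⟨ht, hk, -⟩ := hs
    obtain ⟨hr, hl, hz⟩ := ih ht
    have hc := lapply_eq_count _ t ht k
    simp only [endgame] at hc
    have hr0 := hr k
    have hr1 := hr (k - 1)
    have hl0 := hl k
    have hl1 := hl (k + 1)
    have hz0 := hz k
    simp only [sub_add_cancel, add_sub_cancel_right] at hr1 hl1
    have hkm : |k| < m := by
      by_contra hkm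
      split_ifs at hc <;> grind
    simp only [List.count_append, List.count_singleton, beq_iff_eq]
    refine ⟨fun i hi => ?_, fun i hi => ?_, fun i hi => ?_⟩
    · have := hr i hi
      by_cases h1 : k = i
      · subst h1
        split_ifs at hc ⊢ <;> grind
      · by_cases h2 : k = i + 1
        · subst h2
          split_ifs at hc ⊢ <;> grind
        · simpa [h1, h2] using this
    · have := hl i hi
      by_cases h1 : k = i
      · subst h1
        split_ifs at hc ⊢ <;> grind
      · by_cases h2 : k = i - 1
        · subst h2
          split_ifs at hc ⊢ <;> grind
        · simpa [h1, h2] using this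
    · have := hz i hi
      have h1 : k ≠ i := by rintro rfl; omega
      simpa [h1] using this

/-- A nonzero endgame count arises from a smaller one by firing a site at which `2 * x k + |k|`
is maximal. -/
theorem EndgameCount.exists_last {m : ℕ} {x : ℤ → ℕ} (hx : EndgameCount m x)
    {k₀ : ℤ} (hk₀ : 0 < x k₀) :
    ∃ k, 0 < x k ∧ |k| < m ∧ EndgameCount m (Function.update x k (x k - 1)) ∧
      (k = 0 → x (k - 1) + 1 = x k ∧ x (k + 1) + 1 = x k) ∧
      (k ≠ 0 → x (k - 1) + x (k + 1) + 1 = 2 * x k) := by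
  have hlt : ∀ k, 0 < x k → |k| < m := fun k hk => by
    by_contra h
    have := hx.zero k (by omega)
    omega
  obtain ⟨k, hk, hmax⟩ := Finset.exists_max_image
    ((Finset.Icc (-(m : ℤ)) m).filter (fun k => 0 < x k)) (fun k => 2 * (x k : ℤ) + |k|)
    ⟨k₀, by
      have := abs_lt.1 (hlt k₀ hk₀)
      simp only [Finset.mem_filter, Finset.mem_Icc]
      omega⟩
  have hpos : 0 < x k := (Finset.mem_filter.1 hk).2
  have hmax' : ∀ i, 0 < x i → 2 * (x i : ℤ) + |i| ≤ 2 * (x k : ℤ) + |k| := fun i hi =>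
    hmax i (by
      have := abs_lt.1 (hlt i hi)
      simp only [Finset.mem_filter, Finset.mem_Icc]
      omega)
  have hp := hmax' (k + 1)
  have hn := hmax' (k - 1)
  have hr0 := hx.right k
  have hr1 := hx.right (k - 1)
  have hl0 := hx.left k
  have hl1 := hx.left (k + 1)
  simp only [sub_add_cancel, add_sub_cancel_right] at hr1 hl1
  have hright : 0 ≤ k → x (k + 1) + 1 = x k := by intro h; grind
  have hright' : 0 < k → x (k - 1) = x k := by intro h; grind
  have hleft : k ≤ 0 → x (k - 1) + 1 = x k := by intro h; grind
  have hleft' : k < 0 → x (k + 1) = x k := by intro h; grind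
  refine ⟨k, hpos, hlt k hpos, ⟨fun i hi => ?_, fun i hi => ?_, fun i hi => ?_⟩, ?_, ?_⟩
  · have := hx.right i hi
    simp only [Function.update_apply]
    by_cases h1 : i = k
    · subst h1
      grind
    · by_cases h2 : i + 1 = k
      · subst h2
        grind
      · simpa [h1, h2] using this
  · have := hx.left i hi
    simp only [Function.update_apply]
    by_cases h1 : i = k
    · subst h1
      grind
    · by_cases h2 : i - 1 = k
      · subst h2
        grind
      · simpa [h1, h2] using this
  · have := hx.zero i hi
    simp only [Function.update_apply]
    split_ifs with h
    · subst h
      omega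
    · exact this
  · omega
  · omega

/-- Every endgame count is realised by a legal firing sequence. -/
theorem EndgameCount.exists_lLegal {m : ℕ} {x : ℤ → ℕ} (hx : EndgameCount m x) :
    ∃ s, LLegal (endgame m) s ∧ ∀ k, s.count k = x k := by
  induction hn : ∑ k ∈ Finset.Icc (-(m : ℤ)) m, x k using Nat.strong_induction_on
    generalizing x with
  | _ n ih =>
    by_cases h0 : ∀ k, x k = 0
    · exact ⟨[], trivial, fun k => by simp [h0]⟩
    · push Not at h0
      obtain ⟨k₀, hk₀⟩ := h0
      obtain ⟨k, hpos, hkm, hx', hk0, hk1⟩ := hx.exists_last (Nat.pos_of_ne_zero hk₀)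
      have hlt : ∑ i ∈ Finset.Icc (-(m : ℤ)) m, Function.update x k (x k - 1) i < n := by
        rw [← hn]
        refine Finset.sum_lt_sum (fun i _ => ?_) ⟨k, ?_, ?_⟩
        · simp only [Function.update_apply]
          split_ifs with h
          · subst h
            omega
          · rfl
        · have := abs_lt.1 hkm
          simp only [Finset.mem_Icc]
          omega
        · simp only [Function.update_self]
          omega
      obtain ⟨s, hs, hcount⟩ := ih _ hlt hx' rfl
      refine ⟨s ++ [k], (lLegal_append _ _ _).2 ⟨hs, ?_, trivial⟩, fun i => ?_⟩
      · have h := lapply_eq_count _ s hs k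
        have h1 : k - 1 ≠ k := by omega
        have h2 : k + 1 ≠ k := by omega
        simp only [hcount, Function.update_self, Function.update_of_ne h1,
          Function.update_of_ne h2, endgame] at h
        split_ifs at h <;> omega
      · rw [List.count_append, hcount, List.count_singleton, Function.update_apply]
        by_cases h : i = k
        · subst h
          simp only [if_true, beq_self_eq_true]
          omega
        · simp [h, Ne.symm h]

/-- For chip-firing on the line from the endgame configuration with
`n = 2m` chips, every upward-closed subset `S` of the move poset equals `mv(c₁)` for
some configuration `c₁` reachable from `c₀`. -/
theorem endgame_upward_closed_is_mv
    (m : ℕ) (hm : 1 ≤ m) (c₀ : ℤ → ℕ) (hc₀ : c₀ = endgame m)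
    (hterm : ∃ s, LLegal c₀ s ∧ LStable (lapply c₀ s))
    (N : ℤ → ℕ)
    (hN : ∀ s, LLegal c₀ s → LStable (lapply c₀ s) → ∀ k, s.count k = N k)
    (S : Set (ℤ × ℕ))
    (hSsub : S ⊆ {p : ℤ × ℕ | 1 ≤ p.2 ∧ p.2 ≤ N p.1})
    (hSup : ∀ p ∈ S, ∀ q : ℤ × ℕ, 1 ≤ q.2 ∧ q.2 ≤ N q.1 → LMoveGE c₀ q p → q ∈ S) :
    ∃ c₁ : ℤ → ℕ, ∃ s : List ℤ, LLegal c₀ s ∧ lapply c₀ s = c₁ ∧ Mv s = S := by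
  classical
  subst hc₀
  obtain ⟨s₀, hs₀, hst₀⟩ := hterm
  have hNcount : EndgameCount m N := by
    have h := EndgameCount.of_lLegal hm s₀ hs₀
    rwa [funext (hN s₀ hs₀ hst₀)] at h
  -- `S` contains every move that precedes the `j`-th firing at `k` whenever `(k, j) ∈ S`.
  have hclosed : ∀ k j, (k, j) ∈ S → ∀ q : ℤ × ℕ, 1 ≤ q.2 → q.2 ≤ N q.1 →
      (∀ t : List ℤ, EndgameCount m (fun i => (t ++ [k]).count i) →
        t.count k + 1 = j → q.2 ≤ t.count q.1) → q ∈ S := by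
    intro k j hkj q hq1 hq2 h
    refine hSup _ hkj q ⟨hq1, hq2⟩ (Or.inr ?_)
    rintro ⟨t, u, hleg, hcount, hlt⟩
    have hj : 1 ≤ j := (hSsub hkj).1
    have hleg' : LLegal (endgame m) ((t ++ [k]) ++ u) := by simpa using hleg
    have := h t (EndgameCount.of_lLegal hm _ ((lLegal_append _ _ _).1 hleg').1)
      (by simp only at hcount; omega)
    omega
  have hdown : ∀ k i j, (k, j) ∈ S → 1 ≤ i → i ≤ j → (k, i) ∈ S := by
    intro k i j hkj hi hij
    rcases hij.eq_or_lt with rfl | hlt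
    · exact hkj
    · have hj : j ≤ N k := (hSsub hkj).2
      exact hclosed k j hkj (k, i) hi (by simp only; omega) fun t _ ht => by simp only; omega
  set x : ℤ → ℕ := fun k => Nat.findGreatest (fun j => (k, j) ∈ S) (N k)
  have hxS : ∀ k j, (k, j) ∈ S ↔ 1 ≤ j ∧ j ≤ x k := by
    intro k j
    constructor
    · intro h
      exact ⟨(hSsub h).1, Nat.le_findGreatest (hSsub h).2 h⟩
    · rintro ⟨h1, h2⟩
      have h0 : x k ≠ 0 := by omega
      exact hdown k j (x k) (Nat.findGreatest_of_ne_zero (P := fun j => (k, j) ∈ S) rfl h0) h1 h2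
  have hxN : ∀ k, x k ≤ N k := fun k => Nat.findGreatest_le _
  have hstep : ∀ k l : ℤ, ∀ d : ℕ, k ≠ l →
      (∀ y : ℤ → ℕ, EndgameCount m y → y k ≤ y l + d) → x k ≤ x l + d := by
    intro k l d hkl h
    by_contra! hlt
    have hmem : (l, x k - d) ∈ S := by
      refine hclosed k (x k) ((hxS _ _).2 ⟨by omega, le_rfl⟩) _ (by simp only; omega) ?_ ?_
      · have h1 := h N hNcount
        have h2 := hxN k
        simp only
        omega
      · intro t ht hk
        have := h _ ht
        simp only [List.count_append, List.count_singleton, beq_iff_eq, if_true,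
          if_neg hkl] at this ⊢
        omega
    have := ((hxS _ _).1 hmem).2
    omega
  have hx : EndgameCount m x := by
    refine ⟨fun k hk => ⟨?_, ?_⟩, fun k hk => ⟨?_, ?_⟩, fun k hk => ?_⟩
    · exact hstep (k + 1) k 0 (by omega) fun y hy => (hy.right k hk).1
    · exact hstep k (k + 1) 1 (by omega) fun y hy => (hy.right k hk).2
    · exact hstep (k - 1) k 0 (by omega) fun y hy => (hy.left k hk).1
    · exact hstep k (k - 1) 1 (by omega) fun y hy => (hy.left k hk).2
    · have := hxN k
      rw [hNcount.zero k hk] at this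
      omega
  obtain ⟨s, hs, hcount⟩ := hx.exists_lLegal
  refine ⟨_, s, hs, rfl, ?_⟩
  ext ⟨k, j⟩
  rw [hxS, ← hcount]
  rfl
end

section
/- For chip-firing on the line starting from the endgame configuration c₀ with n = 2m chips, the configuration poset forms a distributive lattice: for all reachable configurations x, y, z, one has x ∧ (y ∨ z) = (x ∧ y) ∨ (x ∧ z). -/
/-- `f` is the vector of firing counts of some configuration reachable from `endgame m`: it vanishes
at the sites `k` with `m ≤ |k|`, and moving one step away from the origin decreases it by `0` or
`1`. -/
structure IsEndgameOdometer (m : ℕ) (f : ℤ → ℕ) : Prop where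
  eq_zero : ∀ k : ℤ, (m : ℤ) ≤ |k| → f k = 0
  right_le : ∀ k : ℤ, 0 ≤ k → f (k + 1) ≤ f k
  le_right : ∀ k : ℤ, 0 ≤ k → f k ≤ f (k + 1) + 1
  left_le : ∀ k : ℤ, k ≤ 0 → f (k - 1) ≤ f k
  le_left : ∀ k : ℤ, k ≤ 0 → f k ≤ f (k - 1) + 1

/-- The configuration obtained from `endgame m` when every site `k` has fired `f k` times. -/
def firedEndgame (m : ℕ) (f : ℤ → ℕ) : ℤ → ℕ :=
  fun k => endgame m k + f (k - 1) + f (k + 1) - 2 * f k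

/-- The firing counts `f` after one more firing at `k`. -/
def addFiring (f : ℤ → ℕ) (k : ℤ) : ℤ → ℕ := fun i => if i = k then f i + 1 else f i

lemma firedEndgame_zero (m : ℕ) : firedEndgame m 0 = endgame m := by
  funext k
  simp [firedEndgame]

namespace IsEndgameOdometer

variable {m : ℕ} {f g : ℤ → ℕ}

lemma zero (m : ℕ) : IsEndgameOdometer m 0 := by
  constructor <;> simp

lemma inf (hf : IsEndgameOdometer m f) (hg : IsEndgameOdometer m g) :
    IsEndgameOdometer m (f ⊓ g) := by
  constructor <;> intro k hk <;> simp only [Pi.inf_apply]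
  · simp [hf.eq_zero k hk]
  · have := hf.right_le k hk; have := hg.right_le k hk; omega
  · have := hf.le_right k hk; have := hg.le_right k hk; omega
  · have := hf.left_le k hk; have := hg.left_le k hk; omega
  · have := hf.le_left k hk; have := hg.le_left k hk; omega

lemma sup (hf : IsEndgameOdometer m f) (hg : IsEndgameOdometer m g) :
    IsEndgameOdometer m (f ⊔ g) := by
  constructor <;> intro k hk <;> simp only [Pi.sup_apply]
  · simp [hf.eq_zero k hk, hg.eq_zero k hk]
  · have := hf.right_le k hk; have := hg.right_le k hk; omega
  · have := hf.le_right k hk; have := hg.le_right k hk; omega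
  · have := hf.left_le k hk; have := hg.left_le k hk; omega
  · have := hf.le_left k hk; have := hg.le_left k hk; omega

lemma firedEndgame_add (hf : IsEndgameOdometer m f) (k : ℤ) :
    firedEndgame m f k + 2 * f k = endgame m k + f (k - 1) + f (k + 1) := by
  suffices 2 * f k ≤ endgame m k + f (k - 1) + f (k + 1) by
    unfold firedEndgame; omega
  by_cases hk : (m : ℤ) ≤ |k|
  · simp [hf.eq_zero k hk]
  have h1 := hf.right_le (k - 1)
  have h2 := hf.le_right k
  have h3 := hf.left_le (k + 1)
  have h4 := hf.le_left k
  simp only [sub_add_cancel, add_sub_cancel_right] at h1 h3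
  have : |k| ≤ (m : ℤ) - 1 := by omega
  unfold endgame
  split_ifs <;> omega

lemma neighbors_of_two_le (hf : IsEndgameOdometer m f) (hm : 1 ≤ m) {k : ℤ}
    (hk : 2 ≤ firedEndgame m f k) :
    |k| < m ∧ (0 ≤ k → f (k + 1) = f k) ∧ (k ≤ 0 → f (k - 1) = f k) ∧
      (0 < k → f (k - 1) = f k + 1) ∧ (k < 0 → f (k + 1) = f k + 1) := by
  have h0 := hf.firedEndgame_add k
  have e0 := hf.eq_zero k
  have e1 := hf.eq_zero (k + 1)
  have e2 := hf.eq_zero (k - 1)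
  have h1 := hf.right_le (k - 1)
  have h2 := hf.le_right k
  have h3 := hf.left_le (k + 1)
  have h4 := hf.le_left k
  have h5 := hf.right_le k
  have h6 := hf.left_le k
  have h7 := hf.le_right (k - 1)
  have h8 := hf.le_left (k + 1)
  simp only [sub_add_cancel, add_sub_cancel_right] at h1 h3 h7 h8
  unfold endgame at h0
  simp only [Int.abs_eq_natAbs] at *
  split_ifs at h0 <;> omega

lemma addFiring (hf : IsEndgameOdometer m f) (hm : 1 ≤ m) {k : ℤ}
    (hk : 2 ≤ firedEndgame m f k) : IsEndgameOdometer m (addFiring f k) := by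
  obtain ⟨h0, h1, h2, h3, h4⟩ := hf.neighbors_of_two_le hm hk
  constructor <;> intro i hi <;> simp only [_root_.addFiring]
  · rw [if_neg (by rintro rfl; omega), hf.eq_zero i hi]
  · have := hf.right_le i hi
    split_ifs with h h' h'
    · omega
    · subst h; simp only [add_sub_cancel_right] at *; omega
    · omega
    · omega
  · have := hf.le_right i hi
    split_ifs with h h' h'
    · omega
    · subst h; omega
    · omega
    · omega
  · have := hf.left_le i hi
    split_ifs with h h' h'
    · omega
    · subst h; simp only [sub_add_cancel] at *; omega
    · omega
    · omega
  · have := hf.le_left i hi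
    split_ifs with h h' h'
    · omega
    · subst h; omega
    · omega
    · omega

lemma lfire_firedEndgame (hf : IsEndgameOdometer m f) (hm : 1 ≤ m) {k : ℤ}
    (hk : 2 ≤ firedEndgame m f k) :
    lfire (firedEndgame m f) k = firedEndgame m (_root_.addFiring f k) := by
  funext i
  have h0 := hf.firedEndgame_add i
  have h1 := (hf.addFiring hm hk).firedEndgame_add i
  simp only [lfire]
  simp only [_root_.addFiring] at h1 ⊢
  split_ifs at h1 ⊢ <;> subst_vars <;> omega

/-- A firing sequence from a fired endgame configuration only increases the firing counts. -/
lemma exists_of_lLegal (hm : 1 ≤ m) (s : List ℤ) (hf : IsEndgameOdometer m f)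
    (hs : LLegal (firedEndgame m f) s) :
    ∃ g, IsEndgameOdometer m g ∧ f ≤ g ∧ lapply (firedEndgame m f) s = firedEndgame m g := by
  induction s generalizing f with
  | nil => exact ⟨f, hf, le_rfl, rfl⟩
  | cons k s ih =>
    obtain ⟨hk, hs⟩ := hs
    rw [hf.lfire_firedEndgame hm hk] at hs
    obtain ⟨g, hg, hle, h⟩ := ih (hf.addFiring hm hk) hs
    refine ⟨g, hg, le_trans (fun i => ?_) hle, ?_⟩
    · simp only [_root_.addFiring]; split_ifs <;> omega
    · rw [lapply, hf.lfire_firedEndgame hm hk, h]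

/-- Finitely supported firing counts are determined by the resulting configuration. -/
lemma firedEndgame_injective (hf : IsEndgameOdometer m f)
    (hg : IsEndgameOdometer m g) (h : firedEndgame m f = firedEndgame m g) : f = g := by
  have key : ∀ n : ℕ, f (m - n) = g (m - n) ∧ f (m - n + 1) = g (m - n + 1) := by
    intro n
    induction n with
    | zero =>
      have a : (m : ℤ) ≤ |(m : ℤ) - (0 : ℕ)| := by simp
      have b : (m : ℤ) ≤ |(m : ℤ) - (0 : ℕ) + 1| := le_trans (by simp) (le_abs_self _)
      simp only [hf.eq_zero _ a, hg.eq_zero _ a, hf.eq_zero _ b, hg.eq_zero _ b, and_self]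
    | succ n ih =>
      have h1 := hf.firedEndgame_add (m - n)
      have h2 := hg.firedEndgame_add (m - n)
      rw [h] at h1
      have e1 : (m : ℤ) - (n + 1 : ℕ) = m - n - 1 := by push_cast; ring
      rw [e1, sub_add_cancel]
      omega
  funext k
  by_cases hk : (m : ℤ) ≤ k
  · have a : (m : ℤ) ≤ |k| := hk.trans (le_abs_self k)
    rw [hf.eq_zero k a, hg.eq_zero k a]
  · have := (key (m - k).toNat).1
    rwa [show (m : ℤ) - ((m - k).toNat : ℤ) = k by omega] at this

/-- Smaller firing counts can be increased towards larger ones by a legal move. -/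
lemma exists_two_le (hf : IsEndgameOdometer m f) (hg : IsEndgameOdometer m g)
    (a b : ℕ) (k : ℤ) (ha : f k = a) (hb : k.natAbs = b) (hk : f k < g k) :
    ∃ k, f k < g k ∧ 2 ≤ firedEndgame m f k := by
  induction a using Nat.strong_induction_on generalizing b k with
  | _ a iha =>
  induction b using Nat.strong_induction_on generalizing k with
  | _ b ihb =>
  by_cases h2 : 2 ≤ firedEndgame m f k
  · exact ⟨k, hk, h2⟩
  have h0 := hf.firedEndgame_add k
  have hkm : ¬ (m : ℤ) ≤ |k| := fun h => by
    have := hg.eq_zero k h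
    omega
  have hkm' : |k| ≤ (m : ℤ) - 1 := by omega
  have r1 := hf.right_le k
  have r2 := hf.le_right k
  have r3 := hg.le_right k
  have l1 := hf.left_le k
  have l2 := hf.le_left k
  have l3 := hg.le_left k
  have s1 := hf.right_le (k - 1)
  have s2 := hf.le_right (k - 1)
  have s3 := hg.right_le (k - 1)
  have t1 := hf.left_le (k + 1)
  have t2 := hf.le_left (k + 1)
  have t3 := hg.left_le (k + 1)
  simp only [sub_add_cancel, add_sub_cancel_right] at s1 s2 s3 t1 t2 t3
  by_cases hr : f (k + 1) < f k
  · exact iha _ (ha ▸ hr) _ (k + 1) rfl rfl (by omega)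
  by_cases hl : f (k - 1) < f k
  · exact iha _ (ha ▸ hl) _ (k - 1) rfl rfl (by omega)
  unfold endgame at h0
  rcases lt_trichotomy k 0 with hk0 | hk0 | hk0
  · rw [if_neg hk0.ne, if_pos hkm'] at h0
    exact ihb _ (by omega) (k + 1) (by omega) rfl (by omega)
  · rw [if_pos hk0] at h0
    omega
  · rw [if_neg hk0.ne', if_pos hkm'] at h0
    exact ihb _ (by omega) (k - 1) (by omega) rfl (by omega)

lemma lReachable_of_le (hm : 1 ≤ m) (hf : IsEndgameOdometer m f) (hg : IsEndgameOdometer m g)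
    (hfg : f ≤ g) : LReachable (firedEndgame m f) (firedEndgame m g) := by
  induction hn : ∑ i ∈ Finset.Icc (-(m : ℤ)) m, (g i - f i) using Nat.strong_induction_on
    generalizing f with
  | _ n ih =>
  by_cases heq : f = g
  · subst heq
    exact ⟨[], trivial, rfl⟩
  obtain ⟨k, hk⟩ := Function.ne_iff.mp heq
  obtain ⟨k, hlt, h2⟩ :=
    exists_two_le hf hg _ _ k rfl rfl (lt_of_le_of_ne (hfg k) hk)
  have hle : _root_.addFiring f k ≤ g := fun i => by
    have := hfg i
    simp only [_root_.addFiring]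
    split_ifs with h
    · subst h; omega
    · exact this
  have hsum : ∑ i ∈ Finset.Icc (-(m : ℤ)) m, (g i - _root_.addFiring f k i) < n := by
    rw [← hn]
    refine Finset.sum_lt_sum (fun i _ => ?_) ⟨k, ?_, ?_⟩
    · simp only [_root_.addFiring]; split_ifs <;> omega
    · have := (hf.neighbors_of_two_le hm h2).1
      rw [abs_lt] at this
      exact Finset.mem_Icc.mpr ⟨this.1.le, this.2.le⟩
    · simp only [_root_.addFiring, if_true]; omega
  obtain ⟨s, hs, hs'⟩ := ih _ hsum (hf.addFiring hm h2) hle rfl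
  rw [← hf.lfire_firedEndgame hm h2] at hs hs'
  exact ⟨k :: s, ⟨h2, hs⟩, hs'⟩

lemma lReachable_iff (hm : 1 ≤ m) (hf : IsEndgameOdometer m f) (hg : IsEndgameOdometer m g) :
    LReachable (firedEndgame m f) (firedEndgame m g) ↔ f ≤ g := by
  refine ⟨fun ⟨s, hs, h⟩ => ?_, lReachable_of_le hm hf hg⟩
  obtain ⟨g', hg', hle, h'⟩ := hf.exists_of_lLegal hm s hs
  rwa [firedEndgame_injective hg hg' (h.symm.trans h')]

end IsEndgameOdometer

open IsEndgameOdometer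

lemma lReachable_endgame_iff {m : ℕ} (hm : 1 ≤ m) (c : ℤ → ℕ) :
    LReachable (endgame m) c ↔ ∃ f, IsEndgameOdometer m f ∧ c = firedEndgame m f := by
  rw [← firedEndgame_zero]
  constructor
  · rintro ⟨s, hs, rfl⟩
    obtain ⟨g, hg, -, h⟩ := (zero m).exists_of_lLegal hm s hs
    exact ⟨g, hg, h⟩
  · rintro ⟨f, hf, rfl⟩
    exact lReachable_of_le hm (zero m) hf (fun _ => Nat.zero_le _)

lemma lIsJoin_endgame_iff {m : ℕ} (hm : 1 ≤ m) {f g : ℤ → ℕ} (hf : IsEndgameOdometer m f)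
    (hg : IsEndgameOdometer m g) (j : ℤ → ℕ) :
    LIsJoin (endgame m) (firedEndgame m f) (firedEndgame m g) j ↔
      j = firedEndgame m (f ⊓ g) := by
  have hfg := hf.inf hg
  constructor
  · rintro ⟨hj, hjf, hjg, hmax⟩
    obtain ⟨h, hh, rfl⟩ := (lReachable_endgame_iff hm j).mp hj
    rw [lReachable_iff hm hh hf] at hjf
    rw [lReachable_iff hm hh hg] at hjg
    have := hmax _ ((lReachable_endgame_iff hm _).mpr ⟨_, hfg, rfl⟩)
      (lReachable_of_le hm hfg hf inf_le_left) (lReachable_of_le hm hfg hg inf_le_right)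
    rw [lReachable_iff hm hfg hh] at this
    rw [le_antisymm (le_inf hjf hjg) this]
  · rintro rfl
    refine ⟨(lReachable_endgame_iff hm _).mpr ⟨_, hfg, rfl⟩,
      lReachable_of_le hm hfg hf inf_le_left, lReachable_of_le hm hfg hg inf_le_right,
      fun c hc hcf hcg => ?_⟩
    obtain ⟨h, hh, rfl⟩ := (lReachable_endgame_iff hm c).mp hc
    rw [lReachable_iff hm hh hf] at hcf
    rw [lReachable_iff hm hh hg] at hcg
    exact lReachable_of_le hm hh hfg (le_inf hcf hcg)

lemma lIsMeet_endgame_iff {m : ℕ} (hm : 1 ≤ m) {f g : ℤ → ℕ} (hf : IsEndgameOdometer m f)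
    (hg : IsEndgameOdometer m g) (j : ℤ → ℕ) :
    LIsMeet (endgame m) (firedEndgame m f) (firedEndgame m g) j ↔
      j = firedEndgame m (f ⊔ g) := by
  have hfg := hf.sup hg
  constructor
  · rintro ⟨hj, hjf, hjg, hmin⟩
    obtain ⟨h, hh, rfl⟩ := (lReachable_endgame_iff hm j).mp hj
    rw [lReachable_iff hm hf hh] at hjf
    rw [lReachable_iff hm hg hh] at hjg
    have := hmin _ ((lReachable_endgame_iff hm _).mpr ⟨_, hfg, rfl⟩)
      (lReachable_of_le hm hf hfg le_sup_left) (lReachable_of_le hm hg hfg le_sup_right)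
    rw [lReachable_iff hm hh hfg] at this
    rw [le_antisymm this (sup_le hjf hjg)]
  · rintro rfl
    refine ⟨(lReachable_endgame_iff hm _).mpr ⟨_, hfg, rfl⟩,
      lReachable_of_le hm hf hfg le_sup_left, lReachable_of_le hm hg hfg le_sup_right,
      fun c hc hcf hcg => ?_⟩
    obtain ⟨h, hh, rfl⟩ := (lReachable_endgame_iff hm c).mp hc
    rw [lReachable_iff hm hf hh] at hcf
    rw [lReachable_iff hm hg hh] at hcg
    exact lReachable_of_le hm hfg hh (sup_le hcf hcg)

/-- For chip-firing on the line from the endgame configuration with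
`n = 2m` chips, the configuration poset forms a distributive lattice: joins and meets
exist, and `x ∧ (y ∨ z) = (x ∧ y) ∨ (x ∧ z)` for all reachable `x`, `y`, `z`. -/
theorem endgame_config_poset_distributive
    (m : ℕ) (hm : 1 ≤ m) (c₀ : ℤ → ℕ) (hc₀ : c₀ = endgame m) :
    (∀ a b : ℤ → ℕ, LReachable c₀ a → LReachable c₀ b →
      (∃ j, LIsJoin c₀ a b j) ∧ (∃ mt, LIsMeet c₀ a b mt)) ∧
    (∀ x y z yz xyz xy xz w : ℤ → ℕ,
      LReachable c₀ x → LReachable c₀ y → LReachable c₀ z →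
      LIsJoin c₀ y z yz →      -- yz = y ∨ z
      LIsMeet c₀ x yz xyz →    -- xyz = x ∧ (y ∨ z)
      LIsMeet c₀ x y xy →      -- xy = x ∧ y
      LIsMeet c₀ x z xz →      -- xz = x ∧ z
      LIsJoin c₀ xy xz w →     -- w = (x ∧ y) ∨ (x ∧ z)
      xyz = w) := by
  subst hc₀
  constructor
  · intro a b ha hb
    obtain ⟨f, hf, rfl⟩ := (lReachable_endgame_iff hm a).mp ha
    obtain ⟨g, hg, rfl⟩ := (lReachable_endgame_iff hm b).mp hb
    exact ⟨⟨_, (lIsJoin_endgame_iff hm hf hg _).mpr rfl⟩,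
      ⟨_, (lIsMeet_endgame_iff hm hf hg _).mpr rfl⟩⟩
  · intro x y z yz xyz xy xz w hx hy hz hyz hxyz hxy hxz hw
    obtain ⟨f, hf, rfl⟩ := (lReachable_endgame_iff hm x).mp hx
    obtain ⟨g, hg, rfl⟩ := (lReachable_endgame_iff hm y).mp hy
    obtain ⟨h, hh, rfl⟩ := (lReachable_endgame_iff hm z).mp hz
    obtain rfl := (lIsJoin_endgame_iff hm hg hh _).mp hyz
    obtain rfl := (lIsMeet_endgame_iff hm hf (hg.inf hh) _).mp hxyz
    obtain rfl := (lIsMeet_endgame_iff hm hf hg _).mp hxy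
    obtain rfl := (lIsMeet_endgame_iff hm hf hh _).mp hxz
    obtain rfl := (lIsJoin_endgame_iff hm (hf.sup hg) (hf.sup hh) _).mp hw
    rw [sup_inf_left]
end

section
/- For chip-firing on the line starting from the endgame configuration c₀ with n = 2m chips, the map sending a reachable configuration c₁ to the complement of mv(c₁) is an order isomorphism from the configuration poset onto the lattice of order ideals (downward-closed subsets) of the move poset. Consequently, the join-irreducible elements of the configuration poset correspond exactly to the elements of the move poset. -/
/-- `c` covers `c'` in the configuration poset of configurations reachable from `c₀`
(ordered by `a ≥ b` iff `b` is reachable from `a`). -/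
def LCovers (c₀ c c' : ℤ → ℕ) : Prop :=
  LReachable c₀ c' ∧ LReachable c c' ∧ c ≠ c' ∧
    ∀ d, LReachable c d → LReachable d c' → d = c ∨ d = c'

lemma endgame_apply (m : ℕ) (k : ℤ) :
    endgame m k = if k = 0 then 2 else if k.natAbs < m then 1 else 0 := by
  unfold endgame
  have : |k| ≤ (m : ℤ) - 1 ↔ k.natAbs < m := by rw [Int.abs_eq_natAbs]; omega
  simp only [this]

/-- The firing-count vectors compatible with the endgame configuration: they vanish outside
`(-m, m)`, weakly decrease away from the origin, and change by at most one at each step. -/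
structure Feasible (m : ℕ) (f : ℤ → ℕ) : Prop where
  supp : ∀ k, m ≤ k.natAbs → f k = 0
  mono : ∀ a b, (a - b).natAbs = 1 → b.natAbs < a.natAbs → f a ≤ f b
  lip : ∀ a b, (a - b).natAbs = 1 → f a ≤ f b + 1

/-- `c` is obtained from `c₀` by firing each site `k` exactly `f k` times. -/
def FiredBy (c₀ f c : ℤ → ℕ) : Prop :=
  ∀ k, c k + 2 * f k = c₀ k + f (k - 1) + f (k + 1)

/-- The vector `f` after one more firing at `k`. -/
def bump (f : ℤ → ℕ) (k : ℤ) : ℤ → ℕ := fun i => if i = k then f i + 1 else f i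

lemma FiredBy.lfire {c₀ f c : ℤ → ℕ} (h : FiredBy c₀ f c) {k : ℤ} (hk : 2 ≤ c k) :
    FiredBy c₀ (bump f k) (lfire c k) := by
  intro i
  have := h i
  unfold _root_.lfire bump
  by_cases h1 : i = k
  · subst h1; simp; omega
  · by_cases h2 : i = k - 1
    · have e1 : k - 1 - 1 ≠ k := by omega
      subst h2; simp [e1] at *; omega
    · by_cases h3 : i = k + 1
      · have e1 : k + 1 + 1 ≠ k := by omega
        subst h3; simp [e1] at *; omega
      · have e1 : i - 1 ≠ k := by omega
        have e2 : i + 1 ≠ k := by omega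
        simp [h1, h2, h3, e1, e2]; omega

lemma FiredBy.unique {c₀ f c c' : ℤ → ℕ} (h : FiredBy c₀ f c) (h' : FiredBy c₀ f c') :
    c = c' := by
  funext k
  have := h k
  have := h' k
  omega

lemma Feasible.zero (m : ℕ) : Feasible m (fun _ => 0) := by
  constructor <;> simp

lemma Feasible.bump_of_le {m : ℕ} (hm : 1 ≤ m) {f c : ℤ → ℕ} (hf : Feasible m f)
    (h : FiredBy (endgame m) f c) {k : ℤ} (hk : 2 ≤ c k) : Feasible m (bump f k) := by
  have e := h k
  rw [endgame_apply] at e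
  have l1 := hf.lip (k - 1) k (by omega)
  have l2 := hf.lip (k + 1) k (by omega)
  have m1 := hf.mono (k - 1) k (by omega)
  have m2 := hf.mono (k + 1) k (by omega)
  have key : k.natAbs < m ∧ ∀ b, (k - b).natAbs = 1 →
      (b.natAbs < k.natAbs → f k + 1 ≤ f b) ∧ f k ≤ f b := by
    refine ⟨by split_ifs at e <;> omega, fun b hb => ?_⟩
    obtain rfl | rfl : b = k - 1 ∨ b = k + 1 := by omega
    all_goals split_ifs at e <;> omega
  refine ⟨fun i hi => ?_, fun a b hab hlt => ?_, fun a b hab => ?_⟩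
  · have := hf.supp i hi
    have : i ≠ k := by rintro rfl; omega
    simp [bump, *]
  · have := hf.mono a b hab hlt
    unfold bump
    split_ifs with h1 h2 h2
    · omega
    · subst h1; exact (key.2 b hab).1 hlt
    · omega
    · omega
  · have := hf.lip a b hab
    unfold bump
    split_ifs with h1 h2 h2
    · omega
    · subst h1; have := (key.2 b hab).2; omega
    · omega
    · omega

lemma Feasible.le_of_bump {m : ℕ} {f c : ℤ → ℕ} {k : ℤ} (hf : Feasible m (bump f k))
    (h : FiredBy (endgame m) f c) : 2 ≤ c k := by
  have e := h k
  rw [endgame_apply] at e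
  have l1 := hf.lip k (k - 1) (by omega)
  have l2 := hf.lip k (k + 1) (by omega)
  have m1 := hf.mono k (k - 1) (by omega)
  have m2 := hf.mono k (k + 1) (by omega)
  have s := hf.supp k
  simp [bump] at l1 l2 m1 m2 s
  split_ifs at e <;> omega

/-- Between two comparable feasible vectors there is always a legal next firing. -/
lemma Feasible.exists_bump {m : ℕ} {f g : ℤ → ℕ} (hf : Feasible m f) (hg : Feasible m g)
    (hne : ∃ k, f k < g k) : ∃ k, f k < g k ∧ Feasible m (bump f k) := by
  classical
  have hex : ∃ n, ∃ k, f k < g k ∧ 2 * f k + k.natAbs = n := by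
    obtain ⟨k, hk⟩ := hne
    exact ⟨_, k, hk, rfl⟩
  obtain ⟨k, hk, hn⟩ := Nat.find_spec hex
  have hmin : ∀ b, f b < g b → 2 * f k + k.natAbs ≤ 2 * f b + b.natAbs := fun b hb => by
    rw [hn]; exact Nat.find_min' hex ⟨b, hb, rfl⟩
  refine ⟨k, hk, fun i hi => ?_, fun a b hab hlt => ?_, fun a b hab => ?_⟩
  · have := hf.supp i hi
    have := hg.supp i hi
    have : i ≠ k := by rintro rfl; omega
    simp [bump, *]
  · have := hf.mono a b hab hlt
    have := hg.mono a b hab hlt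
    have := hmin b
    unfold bump
    split_ifs with h1 h2 h2
    · omega
    · subst h1; omega
    · omega
    · omega
  · have := hf.lip a b hab
    have := hg.lip a b hab
    have := hmin b
    unfold bump
    split_ifs with h1 h2 h2
    · omega
    · subst h1; omega
    · omega
    · omega

lemma bump_le {f g : ℤ → ℕ} (hfg : f ≤ g) {k : ℤ} (hk : f k < g k) : bump f k ≤ g := by
  intro i
  have : f i ≤ g i := hfg i
  unfold bump
  split_ifs with h
  · subst h; exact hk
  · exact this

lemma le_bump (f : ℤ → ℕ) (k : ℤ) : f ≤ bump f k := by
  intro i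
  simp only [bump]
  split_ifs <;> omega

lemma bump_add_count (f : ℤ → ℕ) (k : ℤ) (s : List ℤ) :
    (fun i => bump f k i + s.count i) = fun i => f i + (k :: s).count i := by
  funext i
  simp only [bump, List.count_cons]
  by_cases h : i = k
  · subst h; simp; omega
  · simp [h, Ne.symm h]

lemma Feasible.of_legal {m : ℕ} (hm : 1 ≤ m) (s : List ℤ) : ∀ {f c : ℤ → ℕ}, Feasible m f →
    FiredBy (endgame m) f c → LLegal c s →
    Feasible m (fun i => f i + s.count i) ∧
      FiredBy (endgame m) (fun i => f i + s.count i) (lapply c s) := by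
  induction s with
  | nil => intro f c hf h _; simpa [lapply] using ⟨hf, h⟩
  | cons k s ih =>
    intro f c hf h hs
    have := ih (hf.bump_of_le hm h hs.1) (h.lfire hs.1) hs.2
    rwa [bump_add_count] at this

lemma Feasible.exists_legal {m : ℕ} {g : ℤ → ℕ} (hg : Feasible m g) : ∀ (n : ℕ) {f c : ℤ → ℕ},
    Feasible m f → FiredBy (endgame m) f c → f ≤ g →
    ∑ i ∈ Finset.Icc (-(m : ℤ)) m, (g i - f i) ≤ n →
    ∃ s, LLegal c s ∧ ∀ i, f i + s.count i = g i := by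
  intro n
  induction n with
  | zero =>
    intro f c hf h hfg hn
    refine ⟨[], trivial, fun i => ?_⟩
    have : f i ≤ g i := hfg i
    by_cases hi : m ≤ i.natAbs
    · simp [hf.supp i hi, hg.supp i hi]
    · have := Finset.sum_eq_zero_iff.1 (Nat.le_zero.1 hn) i (by rw [Finset.mem_Icc]; omega)
      simp; omega
  | succ n ih =>
    intro f c hf h hfg hn
    by_cases hne : ∃ k, f k < g k
    · obtain ⟨k, hk, hb⟩ := hf.exists_bump hg hne
      have hc := hb.le_of_bump h
      obtain ⟨s, hs, hs'⟩ := ih hb (h.lfire hc) (bump_le hfg hk) (by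
        have hlt : ∑ i ∈ Finset.Icc (-(m : ℤ)) m, (g i - bump f k i) <
            ∑ i ∈ Finset.Icc (-(m : ℤ)) m, (g i - f i) := by
          refine Finset.sum_lt_sum (fun i _ => ?_) ⟨k, ?_, ?_⟩
          · have : f i ≤ bump f k i := le_bump f k i; omega
          · by_contra hki
            have := hg.supp k (by rw [Finset.mem_Icc] at hki; omega)
            omega
          · simp [bump]; omega
        omega)
      exact ⟨k :: s, ⟨hc, hs⟩, fun i => (congrFun (bump_add_count f k s) i).symm.trans (hs' i)⟩
    · push Not at hne
      exact ⟨[], trivial, fun i => le_antisymm (by simpa using hfg i) (by simpa using hne i)⟩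

lemma FiredBy.injective {m : ℕ} {c₀ f g c : ℤ → ℕ} (hf : Feasible m f) (hg : Feasible m g)
    (h : FiredBy c₀ f c) (h' : FiredBy c₀ g c) : f = g := by
  have key : ∀ n : ℕ, f (-(m : ℤ) - 1 + n) = g (-(m : ℤ) - 1 + n) ∧
      f (-(m : ℤ) - 1 + n + 1) = g (-(m : ℤ) - 1 + n + 1) := by
    intro n
    induction n with
    | zero =>
      constructor <;> rw [hf.supp _ (by omega), hg.supp _ (by omega)]
    | succ n ih =>
      have e1 := h (-(m : ℤ) - 1 + n + 1)
      have e2 := h' (-(m : ℤ) - 1 + n + 1)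
      rw [add_sub_cancel_right] at e1 e2
      push_cast
      rw [← add_assoc]
      exact ⟨ih.2, by omega⟩
  funext k
  by_cases hk : m ≤ k.natAbs
  · rw [hf.supp _ hk, hg.supp _ hk]
  · have := (key (k + m + 1).toNat).1
    rwa [show -(m : ℤ) - 1 + ((k + m + 1).toNat : ℤ) = k by omega] at this

lemma firedBy_zero (c₀ : ℤ → ℕ) : FiredBy c₀ (fun _ => 0) c₀ := fun k => by simp

lemma feasible_count {m : ℕ} (hm : 1 ≤ m) {s : List ℤ} (hs : LLegal (endgame m) s) :
    Feasible m (fun i => s.count i) ∧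
      FiredBy (endgame m) (fun i => s.count i) (lapply (endgame m) s) := by
  simpa using Feasible.of_legal hm s (Feasible.zero m) (firedBy_zero _) hs

lemma Feasible.exists_count_eq {m : ℕ} {f : ℤ → ℕ} (hf : Feasible m f) :
    ∃ s, LLegal (endgame m) s ∧ (fun i => s.count i) = f := by
  obtain ⟨s, hs, h⟩ := hf.exists_legal _ (Feasible.zero m) (firedBy_zero _)
    (fun _ => Nat.zero_le _) le_rfl
  exact ⟨s, hs, funext fun i => by simpa using h i⟩

lemma FiredBy.reachable_iff {m : ℕ} (hm : 1 ≤ m) {f g c d : ℤ → ℕ} (hf : Feasible m f)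
    (hg : Feasible m g) (hc : FiredBy (endgame m) f c) (hd : FiredBy (endgame m) g d) :
    LReachable c d ↔ f ≤ g := by
  constructor
  · rintro ⟨s, hs, rfl⟩
    have := Feasible.of_legal hm s hf hc hs
    rw [FiredBy.injective hg this.1 hd this.2]
    exact fun i => Nat.le_add_right _ _
  · intro hfg
    obtain ⟨s, hs, h⟩ := hg.exists_legal _ hf hc hfg le_rfl
    refine ⟨s, hs, FiredBy.unique ?_ hd⟩
    have := (Feasible.of_legal hm s hf hc hs).2
    rwa [funext h] at this

lemma reachable_iff_exists {m : ℕ} (hm : 1 ≤ m) {c : ℤ → ℕ} :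
    LReachable (endgame m) c ↔ ∃ f, Feasible m f ∧ FiredBy (endgame m) f c := by
  constructor
  · rintro ⟨s, hs, rfl⟩
    exact ⟨_, feasible_count hm hs⟩
  · rintro ⟨f, hf, h⟩
    exact (FiredBy.reachable_iff hm (Feasible.zero m) hf (firedBy_zero _) h).2
      fun _ => Nat.zero_le _

lemma lfire_ne {c : ℤ → ℕ} {k i : ℤ} (hk : 2 ≤ c k) (hik : k ≠ i) : lfire c k k ≠ lfire c i k := by
  have h : c k ≤ lfire c i k := by
    unfold lfire
    rw [if_neg hik]
    split_ifs <;> omega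
  have h' : lfire c k k = c k - 2 := by simp [lfire]
  omega

lemma covers_iff {m : ℕ} (hm : 1 ≤ m) {f c c' : ℤ → ℕ} (hf : Feasible m f)
    (hc : FiredBy (endgame m) f c) :
    LCovers (endgame m) c c' ↔ ∃ k, 2 ≤ c k ∧ c' = lfire c k := by
  constructor
  · rintro ⟨-, ⟨s, hs, rfl⟩, hne, hd⟩
    cases s with
    | nil => exact absurd rfl hne
    | cons k s =>
      refine ⟨k, hs.1, ?_⟩
      obtain h | h := hd (lfire c k) ⟨[k], ⟨hs.1, trivial⟩, rfl⟩ ⟨s, hs.2, rfl⟩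
      · have h1 := congrFun h k
        have h2 := hs.1
        simp only [lfire, if_true] at h1
        omega
      · exact h.symm
  · rintro ⟨k, hk, rfl⟩
    have hb := hf.bump_of_le hm hc hk
    have hcb := hc.lfire hk
    refine ⟨(reachable_iff_exists hm).2 ⟨_, hb, hcb⟩, ⟨[k], ⟨hk, trivial⟩, rfl⟩, ?_, ?_⟩
    · intro h
      have h1 := congrFun h k
      simp only [lfire, if_true] at h1
      omega
    · rintro d ⟨s, hs, rfl⟩ hd
      obtain ⟨hg, hgd⟩ := Feasible.of_legal hm s hf hc hs
      have hle := (FiredBy.reachable_iff hm hg hb hgd hcb).1 hd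
      have hle' : ∀ i, i ≠ k → f i + s.count i = f i := fun i hi => by
        have := hle i
        simp only [bump, if_neg hi] at this
        omega
      have hk' := hle k
      simp only [bump, if_true] at hk'
      by_cases h0 : s.count k = 0
      · left
        refine FiredBy.unique (f := f) ?_ hc
        convert hgd using 1
        funext i
        by_cases hi : i = k
        · subst hi; omega
        · exact (hle' i hi).symm
      · right
        refine FiredBy.unique (f := bump f k) ?_ hcb
        convert hgd using 1
        funext i
        by_cases hi : i = k
        · subst hi; simp only [bump, if_true]; omega
        · rw [hle' i hi]; simp [bump, hi]

lemma existsUnique_covers_iff {m : ℕ} (hm : 1 ≤ m) {f c : ℤ → ℕ} (hf : Feasible m f)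
    (hc : FiredBy (endgame m) f c) :
    (∃! c', LCovers (endgame m) c c') ↔ ∃! k, Feasible m (bump f k) := by
  have hiff : ∀ k, Feasible m (bump f k) ↔ 2 ≤ c k := fun k =>
    ⟨fun h => h.le_of_bump hc, fun h => hf.bump_of_le hm hc h⟩
  simp only [hiff, covers_iff hm hf hc]
  constructor
  · rintro ⟨c', ⟨k, hk, rfl⟩, hu⟩
    refine ⟨k, hk, fun i hi => ?_⟩
    by_contra hne
    exact lfire_ne hk (Ne.symm hne) (congrFun (hu _ ⟨i, hi, rfl⟩).symm k)
  · rintro ⟨k, hk, hu⟩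
    refine ⟨_, ⟨k, hk, rfl⟩, ?_⟩
    rintro _ ⟨i, hi, rfl⟩
    rw [hu i hi]

lemma LLegal.of_append {t u : List ℤ} : ∀ {c : ℤ → ℕ}, LLegal c (t ++ u) → LLegal c t := by
  induction t with
  | nil => intros; trivial
  | cons k t ih => exact fun h => ⟨h.1, ih h.2⟩

lemma List.exists_eq_append_of_count {α : Type*} [DecidableEq α] (x : α) (s : List α) :
    ∀ j, 1 ≤ j → j ≤ s.count x → ∃ t u, s = t ++ x :: u ∧ t.count x = j - 1 := by
  induction s with
  | nil => intro j h1 h2; simp at h2; omega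
  | cons y s ih =>
    intro j h1 h2
    by_cases hy : y = x
    · subst hy
      by_cases hj : j = 1
      · exact ⟨[], s, rfl, by simp [hj]⟩
      · obtain ⟨t, u, rfl, ht⟩ := ih (j - 1) (by omega) (by simp at h2 ⊢; omega)
        exact ⟨y :: t, u, rfl, by simp; omega⟩
    · obtain ⟨t, u, rfl, ht⟩ := ih j h1 (by simpa [List.count_cons, hy] using h2)
      exact ⟨y :: t, u, rfl, by simpa [List.count_cons, hy] using ht⟩

lemma moveGE_iff {m : ℕ} (hm : 1 ≤ m) (p q : ℤ × ℕ) (hq : 1 ≤ q.2) :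
    LMoveGE (endgame m) p q ↔ ∀ g, Feasible m g → q.2 ≤ g q.1 → p.2 ≤ g p.1 := by
  constructor
  · rintro (rfl | h) g hg hqg
    · exact hqg
    · by_contra! hlt
      obtain ⟨s, hs, rfl⟩ := hg.exists_count_eq
      obtain ⟨t, u, rfl, ht⟩ := s.exists_eq_append_of_count q.1 q.2 hq hqg
      refine h ⟨t, u, hs, ht, lt_of_le_of_lt ?_ hlt⟩
      simp
  · intro h
    by_cases hpq : p = q
    · exact Or.inl hpq
    · refine Or.inr ?_
      rintro ⟨t, u, hs, ht, hlt⟩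
      rw [List.append_cons] at hs
      have h1 := h _ (feasible_count hm hs.of_append).1 (by simp; omega)
      simp only [List.count_append, List.count_singleton] at h1
      split_ifs at h1 with h2
      · have h2 : q.1 = p.1 := by simpa using h2
        refine hpq (Prod.ext h2.symm ?_)
        rw [h2] at ht
        omega
      · omega

/-- The largest feasible vector. -/
def maxFires (m : ℕ) : ℤ → ℕ := fun k => m - k.natAbs

lemma feasible_maxFires (m : ℕ) : Feasible m (maxFires m) := by
  constructor <;> intros <;> unfold maxFires <;> omega

lemma Feasible.le_maxFires {m : ℕ} {f : ℤ → ℕ} (hf : Feasible m f) : f ≤ maxFires m := by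
  have key : ∀ d : ℕ, ∀ k : ℤ, m ≤ k.natAbs + d → f k ≤ d := by
    intro d
    induction d with
    | zero => intro k hk; exact (hf.supp k (by omega)).le
    | succ d ih =>
      intro k hk
      by_cases h : 0 ≤ k
      · have := hf.lip k (k + 1) (by omega)
        have := ih (k + 1) (by omega)
        omega
      · have := hf.lip k (k - 1) (by omega)
        have := ih (k - 1) (by omega)
        omega
  exact fun k => key _ k (by unfold maxFires; omega)

lemma count_eq_maxFires {m : ℕ} (hm : 1 ≤ m) {s : List ℤ} (hs : LLegal (endgame m) s)
    (hstab : LStable (lapply (endgame m) s)) : (fun i => s.count i) = maxFires m := by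
  obtain ⟨hf, hc⟩ := feasible_count hm hs
  by_contra hne
  obtain ⟨k, -, hk⟩ := hf.exists_bump (feasible_maxFires m) (by
    by_contra! h
    exact hne (le_antisymm hf.le_maxFires h))
  have := hk.le_of_bump hc
  have := hstab k
  omega

/-- The largest feasible vector that does not yet include the move `p`. -/
noncomputable def lastBefore (m : ℕ) (p : ℤ × ℕ) : ℤ → ℕ :=
  fun b => sSup {n | ∃ g, Feasible m g ∧ g p.1 < p.2 ∧ g b = n}

section lastBefore

variable {m : ℕ} {p : ℤ × ℕ}

lemma bddAbove_lastBefore (m : ℕ) (p : ℤ × ℕ) (b : ℤ) :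
    BddAbove {n | ∃ g, Feasible m g ∧ g p.1 < p.2 ∧ g b = n} := by
  refine ⟨maxFires m b, ?_⟩
  rintro _ ⟨g, hg, -, rfl⟩
  exact hg.le_maxFires b

lemma Feasible.le_lastBefore {g : ℤ → ℕ} (hg : Feasible m g) (hlt : g p.1 < p.2) :
    g ≤ lastBefore m p :=
  fun b => le_csSup (bddAbove_lastBefore m p b) ⟨g, hg, hlt, rfl⟩

lemma exists_lastBefore_eq (m : ℕ) (hp : 1 ≤ p.2) (b : ℤ) :
    ∃ g, Feasible m g ∧ g p.1 < p.2 ∧ g b = lastBefore m p b :=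
  Nat.sSup_mem (s := {n | ∃ g, Feasible m g ∧ g p.1 < p.2 ∧ g b = n})
    ⟨0, _, Feasible.zero m, hp, rfl⟩ (bddAbove_lastBefore m p b)

lemma lastBefore_lt (m : ℕ) (hp : 1 ≤ p.2) : lastBefore m p p.1 < p.2 := by
  obtain ⟨g, -, h, he⟩ := exists_lastBefore_eq m hp p.1
  rwa [← he]

lemma feasible_lastBefore (m : ℕ) (hp : 1 ≤ p.2) : Feasible m (lastBefore m p) := by
  refine ⟨fun k hk => ?_, fun a b hab hlt => ?_, fun a b hab => ?_⟩
  · obtain ⟨g, hg, -, he⟩ := exists_lastBefore_eq m hp k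
    rw [← he, hg.supp k hk]
  · obtain ⟨g, hg, h, he⟩ := exists_lastBefore_eq m hp a
    exact he ▸ (hg.mono a b hab hlt).trans (hg.le_lastBefore h b)
  · obtain ⟨g, hg, h, he⟩ := exists_lastBefore_eq m hp a
    exact he ▸ (hg.lip a b hab).trans (Nat.succ_le_succ (hg.le_lastBefore h b))

lemma eq_of_feasible_bump_lastBefore {k : ℤ} (hp : 1 ≤ p.2)
    (hk : Feasible m (bump (lastBefore m p) k)) : k = p.1 := by
  by_contra hne
  have hlt := lastBefore_lt m hp
  have := hk.le_lastBefore (p := p) (by simpa [bump, Ne.symm hne] using hlt) k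
  simp [bump] at this

lemma feasible_bump_lastBefore (hp : 1 ≤ p.2) (hp' : p.2 ≤ maxFires m p.1) :
    Feasible m (bump (lastBefore m p) p.1) := by
  obtain ⟨k, -, hk⟩ := (feasible_lastBefore m hp).exists_bump (feasible_maxFires m)
    ⟨p.1, (lastBefore_lt m hp).trans_le hp'⟩
  rwa [eq_of_feasible_bump_lastBefore hp hk] at hk

lemma lastBefore_self (hp : 1 ≤ p.2) (hp' : p.2 ≤ maxFires m p.1) :
    lastBefore m p p.1 + 1 = p.2 := by
  refine le_antisymm (lastBefore_lt m hp) ?_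
  by_contra! h
  have := (feasible_bump_lastBefore hp hp').le_lastBefore (p := p) (by simpa [bump] using h) p.1
  simp [bump] at this

lemma existsUnique_bump_lastBefore (hp : 1 ≤ p.2) (hp' : p.2 ≤ maxFires m p.1) :
    ∃! k, Feasible m (bump (lastBefore m p) k) :=
  ⟨p.1, feasible_bump_lastBefore hp hp', fun _ hk => eq_of_feasible_bump_lastBefore hp hk⟩

lemma Feasible.eq_lastBefore {f : ℤ → ℕ} {k : ℤ} (hf : Feasible m f)
    (hu : ∀ i, Feasible m (bump f i) → i = k) : f = lastBefore m (k, f k + 1) := by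
  have hle : f ≤ lastBefore m (k, f k + 1) := hf.le_lastBefore (Nat.lt_succ_self _)
  by_contra hne
  have hp : 1 ≤ (k, f k + 1).2 := Nat.succ_pos _
  obtain ⟨i, hi, hb⟩ := hf.exists_bump (feasible_lastBefore m hp) (by
    by_contra! h
    exact hne (le_antisymm hle h))
  have := lastBefore_lt m hp
  rw [hu i hb] at hi
  simp only at this
  omega

lemma moveGE_iff_lastBefore_le (hm : 1 ≤ m) {q : ℤ × ℕ} (hp : 1 ≤ p.2) (hq : 1 ≤ q.2) :
    LMoveGE (endgame m) p q ↔ lastBefore m p ≤ lastBefore m q := by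
  rw [moveGE_iff hm p q hq]
  constructor
  · intro h
    refine (feasible_lastBefore m hp).le_lastBefore ?_
    by_contra! hle
    exact absurd (h _ (feasible_lastBefore m hp) hle) (not_le.2 (lastBefore_lt m hp))
  · intro h g hg hqg
    by_contra! hlt
    have h1 : g q.1 ≤ lastBefore m p q.1 := hg.le_lastBefore hlt q.1
    have h2 : lastBefore m p q.1 ≤ lastBefore m q q.1 := h q.1
    have h3 := lastBefore_lt m hq
    omega

end lastBefore

/-- A down-closed set of moves is the complement of the moves counted by a feasible vector. -/
lemma exists_feasible_of_ideal {m : ℕ} (hm : 1 ≤ m) {I : Set (ℤ × ℕ)}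
    (hsub : ∀ p ∈ I, 1 ≤ p.2 ∧ p.2 ≤ maxFires m p.1)
    (hI : ∀ p ∈ I, ∀ q : ℤ × ℕ, 1 ≤ q.2 ∧ q.2 ≤ maxFires m q.1 →
      LMoveGE (endgame m) p q → q ∈ I) :
    ∃ f, Feasible m f ∧ ∀ p : ℤ × ℕ, p ∈ I ↔ f p.1 < p.2 ∧ p.2 ≤ maxFires m p.1 := by
  classical
  have hT := feasible_maxFires m
  set P : ℤ → ℕ → Prop := fun k j => j = 0 ∨ (j ≤ maxFires m k ∧ (k, j) ∉ I)
  set f : ℤ → ℕ := fun k => Nat.findGreatest (P k) (maxFires m k)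
  have hfP : ∀ k, P k (f k) := fun k => Nat.findGreatest_spec (Nat.zero_le _) (Or.inl rfl)
  have hfle : ∀ k, f k ≤ maxFires m k := fun k => Nat.findGreatest_le _
  have hle : ∀ k j, P k j → j ≤ f k := by
    intro k j h
    refine Nat.le_findGreatest ?_ h
    rcases h with rfl | h
    · exact Nat.zero_le _
    · exact h.1
  have htrans : ∀ a b j i, P a j → (i ≤ maxFires m b) → j ≠ 0 →
      (∀ g, Feasible m g → j ≤ g a → i ≤ g b) → P b i := by
    intro a b j i h hi hj0 hg
    obtain h | h := h
    · exact absurd h hj0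
    refine Or.inr ⟨hi, fun hmem => h.2 (hI _ hmem _ ⟨Nat.pos_of_ne_zero hj0, h.1⟩ ?_)⟩
    exact (moveGE_iff hm _ _ (Nat.pos_of_ne_zero hj0)).2 hg
  refine ⟨f, ⟨fun k hk => ?_, fun a b hab hlt => ?_, fun a b hab => ?_⟩, ?_⟩
  · have := hfle k
    have := hT.supp k hk
    omega
  · by_cases h0 : f a = 0
    · omega
    · exact hle _ _ (htrans a b _ _ (hfP a) ((hfle a).trans (hT.mono a b hab hlt)) h0
        fun g hg h => h.trans (hg.mono a b hab hlt))
  · by_cases h0 : f a = 0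
    · omega
    · have := hle b (f a - 1) (htrans a b _ _ (hfP a)
        (by have := hfle a; have := hT.lip a b hab; omega) h0
        fun g hg h => by have := hg.lip a b hab; omega)
      omega
  · rintro ⟨k, j⟩
    constructor
    · intro h
      refine ⟨?_, (hsub _ h).2⟩
      by_contra! hj
      simp only at hj
      have h1 := (hsub _ h).1
      simp only at h1
      have := htrans k k (f k) j (hfP k) (hj.trans (hfle k)) (by omega) fun g _ h => hj.trans h
      obtain h2 | h2 := this
      · omega
      · exact h2.2 h
    · rintro ⟨h1, h2⟩
      by_contra h
      have := hle k j (Or.inr ⟨h2, h⟩)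
      simp only at h1
      omega

lemma mem_diff_Mv {T : ℤ → ℕ} {s : List ℤ} {p : ℤ × ℕ} :
    p ∈ {p : ℤ × ℕ | 1 ≤ p.2 ∧ p.2 ≤ T p.1} \ Mv s ↔ s.count p.1 < p.2 ∧ p.2 ≤ T p.1 := by
  simp only [Mv, Set.mem_sdiff, Set.mem_ofPred_eq]
  omega

lemma diff_Mv_subset_iff {T : ℤ → ℕ} {s t : List ℤ}
    (ht : ∀ k, t.count k ≤ T k) :
    {p : ℤ × ℕ | 1 ≤ p.2 ∧ p.2 ≤ T p.1} \ Mv s ⊆ {p : ℤ × ℕ | 1 ≤ p.2 ∧ p.2 ≤ T p.1} \ Mv t ↔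
      (fun k => t.count k) ≤ fun k => s.count k := by
  constructor
  · intro h k
    by_contra! hlt
    have h1 : (k, t.count k) ∈ {p : ℤ × ℕ | 1 ≤ p.2 ∧ p.2 ≤ T p.1} \ Mv t :=
      h (mem_diff_Mv.2 ⟨hlt, ht k⟩)
    exact lt_irrefl _ (mem_diff_Mv.1 h1).1
  · intro h p hp
    rw [mem_diff_Mv] at hp ⊢
    exact ⟨(h p.1).trans_lt hp.1, hp.2⟩

/-- Moves correspond to join-irreducible configurations. -/
lemma exists_moves_equiv {m : ℕ} (hm : 1 ≤ m) :
    ∃ e : {p : ℤ × ℕ // p ∈ {p : ℤ × ℕ | 1 ≤ p.2 ∧ p.2 ≤ maxFires m p.1}} ≃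
        {c : ℤ → ℕ // LReachable (endgame m) c ∧ ∃! c', LCovers (endgame m) c c'},
      ∀ p q, LMoveGE (endgame m) p.1 q.1 ↔ LReachable (e p).1 (e q).1 := by
  have hex : ∀ p : {p : ℤ × ℕ // p ∈ {p : ℤ × ℕ | 1 ≤ p.2 ∧ p.2 ≤ maxFires m p.1}},
      ∃ c, FiredBy (endgame m) (lastBefore m p.1) c := fun p => by
    obtain ⟨s, hs, he⟩ := (feasible_lastBefore m p.2.1).exists_count_eq
    exact ⟨_, he ▸ (feasible_count hm hs).2⟩
  choose c hc using hex
  have hf := fun p : {p : ℤ × ℕ // p ∈ {p : ℤ × ℕ | 1 ≤ p.2 ∧ p.2 ≤ maxFires m p.1}} =>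
    feasible_lastBefore m p.2.1
  refine ⟨Equiv.ofBijective (fun p => ⟨c p, (reachable_iff_exists hm).2 ⟨_, hf p, hc p⟩,
    (existsUnique_covers_iff hm (hf p) (hc p)).2
      (existsUnique_bump_lastBefore p.2.1 p.2.2)⟩) ⟨fun p q hpq => ?_, ?_⟩, fun p q => ?_⟩
  · have hpq : c p = c q := congrArg Subtype.val hpq
    have he : lastBefore m p.1 = lastBefore m q.1 :=
      FiredBy.injective (hf p) (hf q) (hc p) (hpq ▸ hc q)
    have h1 : p.1.1 = q.1.1 := eq_of_feasible_bump_lastBefore q.2.1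
      (he ▸ feasible_bump_lastBefore p.2.1 p.2.2)
    have h2 := lastBefore_self p.2.1 p.2.2
    have h3 := lastBefore_self q.2.1 q.2.2
    rw [he, h1] at h2
    exact Subtype.ext (Prod.ext h1 (h2.symm.trans h3))
  · rintro ⟨d, hd, hu⟩
    obtain ⟨f, hff, hfd⟩ := (reachable_iff_exists hm).1 hd
    obtain ⟨k, hk, huk⟩ := (existsUnique_covers_iff hm hff hfd).1 hu
    have hle := hk.le_maxFires k
    simp only [bump, if_true] at hle
    refine ⟨⟨(k, f k + 1), Nat.succ_pos _, hle⟩, Subtype.ext ?_⟩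
    refine FiredBy.unique (hc _) ?_
    rwa [← hff.eq_lastBefore huk]
  · rw [moveGE_iff_lastBefore_le hm p.2.1 q.2.1]
    exact (FiredBy.reachable_iff hm (hf p) (hf q) (hc p) (hc q)).symm

/-- For chip-firing on the line from the endgame configuration with
`n = 2m` chips, the map `c₁ ↦ (move poset) \ mv(c₁)` is an order isomorphism from the
configuration poset onto the lattice of order ideals (downward-closed subsets) of the
move poset: it is well defined, surjective, injective, and order preserving/reflecting
(with `c₁ ≤ c₂` iff `c₁` is reachable from `c₂`, and ideals ordered by inclusion).
Consequently, the join-irreducible elements of the configuration poset (elements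
covering exactly one element) correspond exactly to the elements of the move poset. -/
theorem endgame_config_poset_orderIso_ideals
    (m : ℕ) (hm : 1 ≤ m) (c₀ : ℤ → ℕ) (hc₀ : c₀ = endgame m)
    (hterm : ∃ s, LLegal c₀ s ∧ LStable (lapply c₀ s))
    (N : ℤ → ℕ)
    (hN : ∀ s, LLegal c₀ s → LStable (lapply c₀ s) → ∀ k, s.count k = N k)
    (moves : Set (ℤ × ℕ)) (hmoves : moves = {p : ℤ × ℕ | 1 ≤ p.2 ∧ p.2 ≤ N p.1}) :
    -- the map is well defined and surjective: the order ideals of the move poset are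
    -- exactly the sets `moves \ mv(c₁)` for `c₁` reachable from `c₀`
    (∀ I : Set (ℤ × ℕ),
      (I ⊆ moves ∧ ∀ p ∈ I, ∀ q ∈ moves, LMoveGE c₀ p q → q ∈ I) ↔
      (∃ c₁ : ℤ → ℕ, ∃ s : List ℤ, LLegal c₀ s ∧ lapply c₀ s = c₁ ∧ I = moves \ Mv s)) ∧
    -- the map preserves and reflects the order
    (∀ c₁ c₂ : ℤ → ℕ, ∀ s₁ s₂ : List ℤ,
      LLegal c₀ s₁ → lapply c₀ s₁ = c₁ → LLegal c₀ s₂ → lapply c₀ s₂ = c₂ →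
      (LReachable c₂ c₁ ↔ moves \ Mv s₁ ⊆ moves \ Mv s₂)) ∧
    -- the map is injective
    (∀ c₁ c₂ : ℤ → ℕ, ∀ s₁ s₂ : List ℤ,
      LLegal c₀ s₁ → lapply c₀ s₁ = c₁ → LLegal c₀ s₂ → lapply c₀ s₂ = c₂ →
      moves \ Mv s₁ = moves \ Mv s₂ → c₁ = c₂) ∧
    -- consequently: the join-irreducibles of the configuration poset form the move poset
    (∃ e : {p : ℤ × ℕ // p ∈ moves} ≃
           {c : ℤ → ℕ // LReachable c₀ c ∧ ∃! c', LCovers c₀ c c'},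
      ∀ p q, LMoveGE c₀ p.1 q.1 ↔ LReachable (e p).1 (e q).1) := by
  subst hc₀
  obtain rfl : N = maxFires m := by
    obtain ⟨s, hs, hstab⟩ := hterm
    rw [← count_eq_maxFires hm hs hstab]
    exact funext fun k => (hN s hs hstab k).symm
  subst hmoves
  have hreach : ∀ s₁ s₂ : List ℤ, LLegal (endgame m) s₁ → LLegal (endgame m) s₂ →
      (LReachable (lapply (endgame m) s₂) (lapply (endgame m) s₁) ↔
        {p : ℤ × ℕ | 1 ≤ p.2 ∧ p.2 ≤ maxFires m p.1} \ Mv s₁ ⊆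
          {p : ℤ × ℕ | 1 ≤ p.2 ∧ p.2 ≤ maxFires m p.1} \ Mv s₂) := by
    intro s₁ s₂ h₁ h₂
    obtain ⟨hf₁, hc₁⟩ := feasible_count hm h₁
    obtain ⟨hf₂, hc₂⟩ := feasible_count hm h₂
    rw [FiredBy.reachable_iff hm hf₂ hf₁ hc₂ hc₁,
      diff_Mv_subset_iff hf₂.le_maxFires]
  refine ⟨fun I => ⟨?_, ?_⟩, ?_, ?_, exists_moves_equiv hm⟩
  · rintro ⟨hsub, hI⟩
    obtain ⟨f, hf, h⟩ := exists_feasible_of_ideal hm hsub hI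
    obtain ⟨s, hs, rfl⟩ := hf.exists_count_eq
    exact ⟨_, s, hs, rfl, Set.ext fun p => (h p).trans mem_diff_Mv.symm⟩
  · rintro ⟨_, s, hs, rfl, rfl⟩
    refine ⟨Set.sdiff_subset, fun p hp q hq hpq => ⟨hq, fun hqs => ?_⟩⟩
    have := (moveGE_iff hm p q hq.1).1 hpq _ (feasible_count hm hs).1 hqs.2
    exact absurd (mem_diff_Mv.1 hp).1 (not_lt.2 this)
  · rintro _ _ s₁ s₂ h₁ rfl h₂ rfl
    exact hreach s₁ s₂ h₁ h₂
  · rintro _ _ s₁ s₂ h₁ rfl h₂ rfl heq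
    obtain ⟨hf₁, hc₁⟩ := feasible_count hm h₁
    obtain ⟨hf₂, hc₂⟩ := feasible_count hm h₂
    have h := le_antisymm
      ((diff_Mv_subset_iff hf₁.le_maxFires).1 heq.ge)
      ((diff_Mv_subset_iff hf₂.le_maxFires).1 heq.le)
    exact FiredBy.unique (f := fun i => s₁.count i) hc₁ (h ▸ hc₂)
end

section
/- For chip-firing on the line starting from c₀ with 5 chips at the origin (c₀(0)=5, c₀(i)=0 otherwise), the configuration poset is a lattice but is not distributive. Specifically, let x be the reachable configuration with x(−2)=1, x(0)=3, x(2)=1 (and 0 elsewhere), y the reachable configuration with y(−2)=1, y(−1)=1, y(1)=3 (and 0 elsewhere), and z the reachable configuration with z(−1)=3, z(1)=1, z(2)=1 (and 0 elsewhere). Then y ∨ z is the configuration with values 2,1,2 at sites −1,0,1; x ∧ (y ∨ z) = x; while x ∧ y and x ∧ z both equal the final configuration with value 1 at each of the sites −2,−1,0,1,2, so (x ∧ y) ∨ (x ∧ z) ≠ x ∧ (y ∨ z). -/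
theorem LReachable.refl (c : ℤ → ℕ) : LReachable c c := ⟨[], trivial, rfl⟩

theorem LReachable.head {c d : ℤ → ℕ} {k : ℤ} (hk : 2 ≤ c k) (h : LReachable (lfire c k) d) :
    LReachable c d := by
  obtain ⟨s, hs, rfl⟩ := h
  exact ⟨k :: s, ⟨hk, hs⟩, rfl⟩

/-- The configuration with `a, b, c, d, e` chips at the sites `-2, -1, 0, 1, 2`. -/
def fiveSites (a b c d e : ℕ) : ℤ → ℕ := fun i =>
  if i = -2 then a else if i = -1 then b else if i = 0 then c else if i = 1 then d
    else if i = 2 then e else 0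

/-- The nine configurations reachable from five chips at the origin. -/
def fiveChipConfig : Fin 9 → ℤ → ℕ
  | 0 => fiveSites 0 0 5 0 0
  | 1 => fiveSites 0 1 3 1 0
  | 2 => fiveSites 0 2 1 2 0
  | 3 => fiveSites 1 0 2 2 0
  | 4 => fiveSites 0 2 2 0 1
  | 5 => fiveSites 1 0 3 0 1
  | 6 => fiveSites 1 1 0 3 0
  | 7 => fiveSites 0 3 0 1 1
  | 8 => fiveSites 1 1 1 1 1

/-- `(i, k, j)` is listed when firing site `k` turns `fiveChipConfig i` into
`fiveChipConfig j`. -/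
def fiveChipEdges : List (Fin 9 × ℤ × Fin 9) :=
  [(0, 0, 1), (1, 0, 2), (2, -1, 3), (2, 1, 4), (3, 1, 5), (3, 0, 6), (4, -1, 5), (4, 0, 7),
    (5, 0, 8), (6, 1, 8), (7, -1, 8)]

/-- `FiveChipLE i j` holds when `fiveChipConfig j` is reachable from `fiveChipConfig i`. -/
def FiveChipLE (i j : Fin 9) : Prop :=
  i = j ∨ (i ≤ 2 ∧ i ≤ j) ∨ j = 8 ∨ (i = 3 ∧ (j = 5 ∨ j = 6)) ∨ (i = 4 ∧ (j = 5 ∨ j = 7))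

instance : DecidableRel FiveChipLE := fun i j => by unfold FiveChipLE; infer_instance

theorem FiveChipLE.trans : ∀ {i j k : Fin 9}, FiveChipLE i j → FiveChipLE j k →
    FiveChipLE i k := by
  decide

theorem FiveChipLE.of_edge :
    ∀ e ∈ fiveChipEdges, FiveChipLE e.1 e.2.2 := by
  decide

theorem FiveChipLE.eq_or_edge : ∀ i j : Fin 9, FiveChipLE i j →
    i = j ∨ ∃ e ∈ fiveChipEdges, e.1 = i ∧ i < e.2.2 ∧ FiveChipLE e.2.2 j := by
  decide

theorem fiveChipConfig_injective : Function.Injective fiveChipConfig := by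
  have key : ∀ i j : Fin 9, (∀ k ∈ Finset.Icc (-2 : ℤ) 2, fiveChipConfig i k = fiveChipConfig j k) →
      i = j := by
    decide
  exact fun i j h => key i j fun k _ => congrFun h k

theorem fiveChipConfig_eq_zero (i : Fin 9) {k : ℤ} (hk : k ∉ Finset.Icc (-2 : ℤ) 2) :
    fiveChipConfig i k = 0 := by
  rw [Finset.mem_Icc] at hk
  fin_cases i <;> simp only [fiveChipConfig, fiveSites] <;> grind

theorem exists_fiveChipEdge (i : Fin 9) (k : ℤ) (h : 2 ≤ fiveChipConfig i k) :
    ∃ j, (i, k, j) ∈ fiveChipEdges := by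
  have key : ∀ i : Fin 9, ∀ k ∈ Finset.Icc (-2 : ℤ) 2, 2 ≤ fiveChipConfig i k →
      ∃ j, (i, k, j) ∈ fiveChipEdges := by
    decide
  refine key i k ?_ h
  by_contra hk
  simp [fiveChipConfig_eq_zero i hk] at h

theorem two_le_of_fiveChipEdge :
    ∀ e ∈ fiveChipEdges, 2 ≤ fiveChipConfig e.1 e.2.1 := by
  decide

theorem lfire_of_fiveChipEdge (e : Fin 9 × ℤ × Fin 9) (he : e ∈ fiveChipEdges) :
    lfire (fiveChipConfig e.1) e.2.1 = fiveChipConfig e.2.2 := by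
  have key : ∀ e ∈ fiveChipEdges, ∀ k ∈ Finset.Icc (-2 : ℤ) 2,
      lfire (fiveChipConfig e.1) e.2.1 k = fiveChipConfig e.2.2 k := by
    decide
  have site : ∀ e ∈ fiveChipEdges, -1 ≤ e.2.1 ∧ e.2.1 ≤ 1 := by
    decide
  ext k
  by_cases hk : k ∈ Finset.Icc (-2 : ℤ) 2
  · exact key e he k hk
  · have hs := site e he
    have h₀ := fiveChipConfig_eq_zero e.1 hk
    rw [fiveChipConfig_eq_zero _ hk]
    rw [Finset.mem_Icc] at hk
    simp only [lfire]
    grind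

theorem exists_lapply_fiveChipConfig (s : List ℤ) : ∀ i, LLegal (fiveChipConfig i) s →
    ∃ j, FiveChipLE i j ∧ lapply (fiveChipConfig i) s = fiveChipConfig j := by
  induction s with
  | nil => exact fun i _ => ⟨i, Or.inl rfl, rfl⟩
  | cons k s ih =>
    rintro i ⟨hk, hs⟩
    obtain ⟨m, hm⟩ := exists_fiveChipEdge i k hk
    have hfire : lfire (fiveChipConfig i) k = fiveChipConfig m := lfire_of_fiveChipEdge _ hm
    rw [hfire] at hs
    obtain ⟨j, hj, hsj⟩ := ih m hs
    exact ⟨j, (FiveChipLE.of_edge _ hm).trans hj, by rw [lapply, hfire, hsj]⟩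

theorem FiveChipLE.lreachable {i j : Fin 9} (h : FiveChipLE i j) :
    LReachable (fiveChipConfig i) (fiveChipConfig j) := by
  obtain rfl | ⟨e, he, rfl, hlt, hle⟩ := FiveChipLE.eq_or_edge i j h
  · exact .refl _
  · refine .head (two_le_of_fiveChipEdge e he) ?_
    rw [lfire_of_fiveChipEdge e he]
    exact hle.lreachable
termination_by 9 - i.val
decreasing_by subst_vars; omega

theorem lreachable_fiveChipConfig_iff {i j : Fin 9} :
    LReachable (fiveChipConfig i) (fiveChipConfig j) ↔ FiveChipLE i j := by
  refine ⟨?_, FiveChipLE.lreachable⟩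
  rintro ⟨s, hs, hsj⟩
  obtain ⟨m, hm, hsm⟩ := exists_lapply_fiveChipConfig s i hs
  rwa [fiveChipConfig_injective (hsj.symm.trans hsm)]

theorem exists_fiveChipConfig_of_lreachable {i : Fin 9} {c : ℤ → ℕ}
    (h : LReachable (fiveChipConfig i) c) : ∃ j, fiveChipConfig j = c := by
  obtain ⟨s, hs, rfl⟩ := h
  obtain ⟨j, -, hj⟩ := exists_lapply_fiveChipConfig s i hs
  exact ⟨j, hj.symm⟩

theorem forall_lreachable_fiveChipConfig {i : Fin 9} {P : (ℤ → ℕ) → Prop} :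
    (∀ c, LReachable (fiveChipConfig i) c → P c) ↔
      ∀ j, FiveChipLE i j → P (fiveChipConfig j) := by
  refine ⟨fun h j hj => h _ hj.lreachable, fun h c hc => ?_⟩
  obtain ⟨j, rfl⟩ := exists_fiveChipConfig_of_lreachable hc
  exact h j (lreachable_fiveChipConfig_iff.1 hc)

theorem lIsJoin_fiveChipConfig_iff {o a b j : Fin 9} :
    LIsJoin (fiveChipConfig o) (fiveChipConfig a) (fiveChipConfig b) (fiveChipConfig j) ↔
      FiveChipLE o j ∧ FiveChipLE j a ∧ FiveChipLE j b ∧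
        ∀ c, FiveChipLE o c → FiveChipLE c a → FiveChipLE c b → FiveChipLE c j := by
  simp only [LIsJoin, forall_lreachable_fiveChipConfig, lreachable_fiveChipConfig_iff]

theorem lIsMeet_fiveChipConfig_iff {o a b m : Fin 9} :
    LIsMeet (fiveChipConfig o) (fiveChipConfig a) (fiveChipConfig b) (fiveChipConfig m) ↔
      FiveChipLE o m ∧ FiveChipLE a m ∧ FiveChipLE b m ∧
        ∀ c, FiveChipLE o c → FiveChipLE a c → FiveChipLE b c → FiveChipLE m c := by
  simp only [LIsMeet, forall_lreachable_fiveChipConfig, lreachable_fiveChipConfig_iff]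

theorem exists_fiveChip_join : ∀ a b : Fin 9, ∃ j, FiveChipLE 0 j ∧ FiveChipLE j a ∧
    FiveChipLE j b ∧ ∀ c, FiveChipLE 0 c → FiveChipLE c a → FiveChipLE c b → FiveChipLE c j := by
  decide

theorem exists_fiveChip_meet : ∀ a b : Fin 9, ∃ m, FiveChipLE 0 m ∧ FiveChipLE a m ∧
    FiveChipLE b m ∧ ∀ c, FiveChipLE 0 c → FiveChipLE a c → FiveChipLE b c → FiveChipLE m c := by
  decide

/-- For chip-firing on the line starting with 5 chips at the origin,
the configuration poset is a lattice but is not distributive, witnessed by the explicit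
configurations `x = 10̲301`, `y = 110̲3`, `z = 30̲11`: `y ∨ z = 21̲2`,
`x ∧ (y ∨ z) = x`, while `x ∧ y = x ∧ z = 111̲11 ≠ x`. -/
theorem five_chips_not_distributive
    (c₀ x y z w f : ℤ → ℕ)
    (hc₀ : c₀ = fun i => if i = 0 then 5 else 0)
    (hx : x = fun i => if i = -2 then 1 else if i = 0 then 3 else if i = 2 then 1 else 0)
    (hy : y = fun i => if i = -2 then 1 else if i = -1 then 1 else if i = 1 then 3 else 0)
    (hz : z = fun i => if i = -1 then 3 else if i = 1 then 1 else if i = 2 then 1 else 0)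
    (hw : w = fun i => if i = -1 then 2 else if i = 0 then 1 else if i = 1 then 2 else 0)
    (hf : f = fun i => if |i| ≤ 2 then 1 else 0) :
    -- the configuration poset is a lattice
    (∀ a b : ℤ → ℕ, LReachable c₀ a → LReachable c₀ b →
      (∃ j, LIsJoin c₀ a b j) ∧ (∃ mt, LIsMeet c₀ a b mt)) ∧
    -- x, y, z are reachable from c₀
    LReachable c₀ x ∧ LReachable c₀ y ∧ LReachable c₀ z ∧
    -- y ∨ z = w = 21̲2
    LIsJoin c₀ y z w ∧
    -- x ∧ (y ∨ z) = x
    LIsMeet c₀ x w x ∧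
    -- x ∧ y = x ∧ z = f = 111̲11
    LIsMeet c₀ x y f ∧ LIsMeet c₀ x z f ∧
    -- (x ∧ y) ∨ (x ∧ z) = f ∨ f = f
    LIsJoin c₀ f f f ∧
    -- so (x ∧ y) ∨ (x ∧ z) ≠ x ∧ (y ∨ z)
    f ≠ x ∧
    -- hence the lattice is not distributive
    ¬ (∀ x' y' z' yz' xyz' xy' xz' w' : ℤ → ℕ,
        LReachable c₀ x' → LReachable c₀ y' → LReachable c₀ z' →
        LIsJoin c₀ y' z' yz' → LIsMeet c₀ x' yz' xyz' →
        LIsMeet c₀ x' y' xy' → LIsMeet c₀ x' z' xz' →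
        LIsJoin c₀ xy' xz' w' → xyz' = w') := by
  obtain rfl : c₀ = fiveChipConfig 0 := by
    subst hc₀; ext i; simp only [fiveChipConfig, fiveSites]; grind
  obtain rfl : x = fiveChipConfig 5 := by
    subst hx; ext i; simp only [fiveChipConfig, fiveSites]; grind
  obtain rfl : y = fiveChipConfig 6 := by
    subst hy; ext i; simp only [fiveChipConfig, fiveSites]; grind
  obtain rfl : z = fiveChipConfig 7 := by
    subst hz; ext i; simp only [fiveChipConfig, fiveSites]; grind
  obtain rfl : w = fiveChipConfig 2 := by
    subst hw; ext i; simp only [fiveChipConfig, fiveSites]; grind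
  obtain rfl : f = fiveChipConfig 8 := by
    subst hf; ext i; simp only [fiveChipConfig, fiveSites, abs_le]; grind
  clear hc₀ hx hy hz hw hf
  have hx : LReachable (fiveChipConfig 0) (fiveChipConfig 5) :=
    lreachable_fiveChipConfig_iff.2 (by decide)
  have hy : LReachable (fiveChipConfig 0) (fiveChipConfig 6) :=
    lreachable_fiveChipConfig_iff.2 (by decide)
  have hz : LReachable (fiveChipConfig 0) (fiveChipConfig 7) :=
    lreachable_fiveChipConfig_iff.2 (by decide)
  have hyz : LIsJoin (fiveChipConfig 0) (fiveChipConfig 6) (fiveChipConfig 7)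
      (fiveChipConfig 2) := lIsJoin_fiveChipConfig_iff.2 (by decide)
  have hxw : LIsMeet (fiveChipConfig 0) (fiveChipConfig 5) (fiveChipConfig 2)
      (fiveChipConfig 5) := lIsMeet_fiveChipConfig_iff.2 (by decide)
  have hxy : LIsMeet (fiveChipConfig 0) (fiveChipConfig 5) (fiveChipConfig 6)
      (fiveChipConfig 8) := lIsMeet_fiveChipConfig_iff.2 (by decide)
  have hxz : LIsMeet (fiveChipConfig 0) (fiveChipConfig 5) (fiveChipConfig 7)
      (fiveChipConfig 8) := lIsMeet_fiveChipConfig_iff.2 (by decide)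
  have hff : LIsJoin (fiveChipConfig 0) (fiveChipConfig 8) (fiveChipConfig 8)
      (fiveChipConfig 8) := lIsJoin_fiveChipConfig_iff.2 (by decide)
  have hfx : fiveChipConfig 8 ≠ fiveChipConfig 5 := fiveChipConfig_injective.ne (by decide)
  refine ⟨fun a b ha hb => ?_, hx, hy, hz, hyz, hxw, hxy, hxz, hff, hfx, fun h =>
    hfx (h _ _ _ _ _ _ _ _ hx hy hz hyz hxw hxy hxz hff).symm⟩
  obtain ⟨a, rfl⟩ := exists_fiveChipConfig_of_lreachable ha
  obtain ⟨b, rfl⟩ := exists_fiveChipConfig_of_lreachable hb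
  obtain ⟨j, hj⟩ := exists_fiveChip_join a b
  obtain ⟨m, hm⟩ := exists_fiveChip_meet a b
  exact ⟨⟨_, lIsJoin_fiveChipConfig_iff.2 hj⟩, ⟨_, lIsMeet_fiveChipConfig_iff.2 hm⟩⟩
end

section
/- For chip-firing on the line starting from c₀ with 8 chips at the origin (c₀(0)=8, c₀(i)=0 otherwise), the configuration poset is a lattice but is not distributive. Specifically, let x be the reachable configuration with values 2,0,3,2,1 at sites −2,−1,0,1,2 (and 0 elsewhere), y the reachable configuration with values 2,1,0,5 at sites −2,−1,0,1 (and 0 elsewhere), and z the reachable configuration with values 1,3,0,3,1 at sites −2,−1,0,1,2 (and 0 elsewhere). Then y ∨ z has values 1,2,1,4 at sites −2,−1,0,1; x ∧ (y ∨ z) = x; while x ∧ y and x ∧ z both equal the configuration with values 2,1,1,3,1 at sites −2,−1,0,1,2, so (x ∧ y) ∨ (x ∧ z) ≠ x ∧ (y ∨ z). -/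
theorem lapply_add_two_mul_count {c : ℤ → ℕ} {s : List ℤ} (hs : LLegal c s) (i : ℤ) :
    lapply c s i + 2 * s.count i = c i + s.count (i - 1) + s.count (i + 1) := by
  induction s generalizing c with
  | nil => simp [lapply]
  | cons k s ih =>
    have h := ih hs.2
    have hk := hs.1
    simp only [lapply, List.count_cons, beq_iff_eq]
    simp only [lfire] at h
    by_cases h₁ : i = k
    · subst h₁
      simp only [if_true] at h ⊢
      rw [if_neg (by omega : ¬ i = i - 1), if_neg (by omega : ¬ i = i + 1)]
      omega
    · rw [if_neg h₁] at h
      rw [if_neg (Ne.symm h₁)]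
      split_ifs at h ⊢ <;> omega

theorem lapply_eq_of_count_eq {c : ℤ → ℕ} {s t : List ℤ} (hs : LLegal c s) (ht : LLegal c t)
    (h : ∀ k, s.count k = t.count k) : lapply c s = lapply c t := by
  funext i
  have h₁ := lapply_add_two_mul_count hs i
  have h₂ := lapply_add_two_mul_count ht i
  rw [h, h, h] at h₁
  omega

theorem exists_forall_lt_count_eq_zero (s : List ℤ) : ∃ N : ℤ, ∀ i < N, s.count i = 0 := by
  induction s with
  | nil => exact ⟨0, by simp⟩
  | cons k s ih =>
    obtain ⟨N, hN⟩ := ih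
    refine ⟨min N k, fun i hi => ?_⟩
    rw [List.count_cons_of_ne (by have := min_le_right N k; omega)]
    exact hN i (lt_of_lt_of_le hi (min_le_left _ _))

/-- A legal firing sequence is determined up to order by its final configuration. -/
theorem count_eq_of_lapply_eq {c : ℤ → ℕ} {s t : List ℤ} (hs : LLegal c s) (ht : LLegal c t)
    (h : lapply c s = lapply c t) (k : ℤ) : s.count k = t.count k := by
  obtain ⟨N, hN⟩ := exists_forall_lt_count_eq_zero (s ++ t)
  simp only [List.count_append, Nat.add_eq_zero_iff] at hN
  have key : ∀ n : ℕ, ∀ i < N + n, s.count i = t.count i := by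
    intro n
    induction n with
    | zero =>
      intro i hi
      have := hN i (by simpa using hi)
      omega
    | succ n ih =>
      intro i hi
      have h₁ := lapply_add_two_mul_count hs (i - 1)
      have h₂ := lapply_add_two_mul_count ht (i - 1)
      rw [h, ih (i - 1) (by push_cast at hi; omega),
        ih (i - 1 - 1) (by push_cast at hi; omega), sub_add_cancel] at h₁
      rw [sub_add_cancel] at h₂
      omega
  exact key (k - N + 1).toNat k (by omega)

/-- The exchange property of chip-firing: after `s`, one can legally perform exactly those
firings of `t` that exceed the ones in `s`. -/
theorem exists_lLegal_count_eq_sub {c : ℤ → ℕ} {s : List ℤ} (hs : LLegal c s) (t : List ℤ)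
    (ht : LLegal c t) :
    ∃ r, LLegal (lapply c s) r ∧ ∀ k, r.count k = t.count k - s.count k := by
  induction t using List.reverseRecOn with
  | nil => exact ⟨[], trivial, by simp⟩
  | append_singleton t k ih =>
    obtain ⟨ht, hk, -⟩ := (lLegal_append _ _ _).1 ht
    obtain ⟨r, hr, hc⟩ := ih ht
    by_cases hlt : t.count k < s.count k
    · refine ⟨r, hr, fun i => ?_⟩
      rw [hc, List.count_append, List.count_singleton]
      by_cases hi : k = i
      · subst hi
        simp only [beq_self_eq_true, if_true]
        omega
      · simp [hi]
    · refine ⟨r ++ [k], (lLegal_append _ _ _).2 ⟨hr, ?_, trivial⟩, fun i => ?_⟩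
      · rw [← lapply_append]
        have h₁ := lapply_add_two_mul_count ((lLegal_append _ _ _).2 ⟨hs, hr⟩) k
        have h₂ := lapply_add_two_mul_count ht k
        simp only [List.count_append, hc] at h₁
        omega
      · rw [List.count_append, List.count_append, hc, List.count_singleton]
        by_cases hi : k = i
        · subst hi
          simp only [beq_self_eq_true, if_true]
          omega
        · simp [hi]

theorem lReachable_lapply_iff {c : ℤ → ℕ} {s t : List ℤ} (hs : LLegal c s) (ht : LLegal c t) :
    LReachable (lapply c s) (lapply c t) ↔ ∀ k, s.count k ≤ t.count k := by
  constructor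
  · rintro ⟨r, hr, h⟩ k
    rw [← lapply_append] at h
    have := count_eq_of_lapply_eq ((lLegal_append _ _ _).2 ⟨hs, hr⟩) ht h k
    rw [List.count_append] at this
    omega
  · intro h
    obtain ⟨r, hr, hc⟩ := exists_lLegal_count_eq_sub hs t ht
    refine ⟨r, hr, ?_⟩
    rw [← lapply_append]
    refine lapply_eq_of_count_eq ((lLegal_append _ _ _).2 ⟨hs, hr⟩) ht fun k => ?_
    have := h k
    rw [List.count_append, hc]
    omega

theorem lIsMeet_lapply {c : ℤ → ℕ} {s t m : List ℤ} (hs : LLegal c s) (ht : LLegal c t)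
    (hm : LLegal c m) (h : ∀ k, m.count k = max (s.count k) (t.count k)) :
    LIsMeet c (lapply c s) (lapply c t) (lapply c m) := by
  refine ⟨⟨m, hm, rfl⟩, (lReachable_lapply_iff hs hm).2 fun k => ?_,
    (lReachable_lapply_iff ht hm).2 fun k => ?_, ?_⟩
  · exact h k ▸ le_max_left _ _
  · exact h k ▸ le_max_right _ _
  · rintro _ ⟨u, hu, rfl⟩ h₁ h₂
    rw [lReachable_lapply_iff hs hu] at h₁
    rw [lReachable_lapply_iff ht hu] at h₂
    exact (lReachable_lapply_iff hm hu).2 fun k => h k ▸ max_le (h₁ k) (h₂ k)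

theorem lIsJoin_lapply {c : ℤ → ℕ} {s t j : List ℤ} (hs : LLegal c s) (ht : LLegal c t)
    (hj : LLegal c j) (hjs : ∀ k, j.count k ≤ s.count k) (hjt : ∀ k, j.count k ≤ t.count k)
    (h : ∀ u, LLegal c u → (∀ k, u.count k ≤ s.count k) → (∀ k, u.count k ≤ t.count k) →
      ∀ k, u.count k ≤ j.count k) :
    LIsJoin c (lapply c s) (lapply c t) (lapply c j) := by
  refine ⟨⟨j, hj, rfl⟩, (lReachable_lapply_iff hj hs).2 hjs,
    (lReachable_lapply_iff hj ht).2 hjt, ?_⟩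
  rintro _ ⟨u, hu, rfl⟩ h₁ h₂
  exact (lReachable_lapply_iff hu hj).2
    (h u hu ((lReachable_lapply_iff hu hs).1 h₁) ((lReachable_lapply_iff hu ht).1 h₂))

theorem exists_lIsMeet {c a b : ℤ → ℕ} (ha : LReachable c a) (hb : LReachable c b) :
    ∃ m, LIsMeet c a b m := by
  obtain ⟨s, hs, rfl⟩ := ha
  obtain ⟨t, ht, rfl⟩ := hb
  obtain ⟨r, hr, hc⟩ := exists_lLegal_count_eq_sub hs t ht
  refine ⟨_, lIsMeet_lapply hs ht ((lLegal_append _ _ _).2 ⟨hs, hr⟩) fun k => ?_⟩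
  rw [List.count_append, hc]
  omega

theorem exists_lIsJoin {c a b : ℤ → ℕ} (ha : LReachable c a) (hb : LReachable c b) :
    ∃ j, LIsJoin c a b j := by
  obtain ⟨s, hs, rfl⟩ := ha
  obtain ⟨t, ht, rfl⟩ := hb
  let S : Set (List ℤ) :=
    {u | LLegal c u ∧ (∀ k, u.count k ≤ s.count k) ∧ ∀ k, u.count k ≤ t.count k}
  obtain ⟨j, ⟨hj, hjs, hjt⟩, hmax⟩ :=
    (measure fun u : List ℤ => s.length - u.length).wf.has_min S
      ⟨[], trivial, by simp, by simp⟩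
  refine ⟨_, lIsJoin_lapply hs ht hj hjs hjt fun u hu hus hut => ?_⟩
  obtain ⟨r, hr, hc⟩ := exists_lLegal_count_eq_sub hj u hu
  have hmem : j ++ r ∈ S := by
    refine ⟨(lLegal_append _ _ _).2 ⟨hj, hr⟩, fun k => ?_, fun k => ?_⟩
    · have := hjs k
      have := hus k
      rw [List.count_append, hc]
      omega
    · have := hjt k
      have := hut k
      rw [List.count_append, hc]
      omega
  have hle : (j ++ r).length ≤ s.length :=
    (List.subperm_ext_iff.2 fun k _ => hmem.2.1 k).length_le
  have hr0 : r = [] := by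
    have hnot : ¬ s.length - (j ++ r).length < s.length - j.length := hmax _ hmem
    rw [List.length_append] at hnot hle
    exact List.eq_nil_of_length_eq_zero (by omega)
  intro k
  have := hc k
  rw [hr0, List.count_nil] at this
  omega

/-- Fire the origin four times, then `-1`, `1` and the origin `a`, `b` and `d` times. -/
def originFiring (a b d : ℕ) : List ℤ :=
  List.replicate 4 0 ++ List.replicate a (-1) ++ List.replicate b 1 ++ List.replicate d 0

theorem count_originFiring (a b d : ℕ) (k : ℤ) :
    (originFiring a b d).count k =
      if k = 0 then 4 + d else if k = -1 then a else if k = 1 then b else 0 := by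
  simp only [originFiring, List.count_append, List.count_replicate, beq_iff_eq]
  split_ifs <;> omega

/-- For chip-firing on the line starting with 8 chips at the origin,
the configuration poset is a lattice but is not distributive, witnessed by the explicit
configurations `x = 203̲21`, `y = 210̲5`, `z = 130̲31`: `y ∨ z = 121̲4`,
`x ∧ (y ∨ z) = x`, while `x ∧ y = x ∧ z = 211̲31 ≠ x`. -/
theorem eight_chips_not_distributive
    (c₀ x y z w f : ℤ → ℕ)
    (hc₀ : c₀ = fun i => if i = 0 then 8 else 0)
    (hx : x = fun i => if i = -2 then 2 else if i = -1 then 0 else if i = 0 then 3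
      else if i = 1 then 2 else if i = 2 then 1 else 0)
    (hy : y = fun i => if i = -2 then 2 else if i = -1 then 1 else if i = 0 then 0
      else if i = 1 then 5 else 0)
    (hz : z = fun i => if i = -2 then 1 else if i = -1 then 3 else if i = 0 then 0
      else if i = 1 then 3 else if i = 2 then 1 else 0)
    (hw : w = fun i => if i = -2 then 1 else if i = -1 then 2 else if i = 0 then 1
      else if i = 1 then 4 else 0)
    (hf : f = fun i => if i = -2 then 2 else if i = -1 then 1 else if i = 0 then 1
      else if i = 1 then 3 else if i = 2 then 1 else 0) :
    -- the configuration poset is a lattice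
    (∀ a b : ℤ → ℕ, LReachable c₀ a → LReachable c₀ b →
      (∃ j, LIsJoin c₀ a b j) ∧ (∃ mt, LIsMeet c₀ a b mt)) ∧
    -- x, y, z are reachable from c₀
    LReachable c₀ x ∧ LReachable c₀ y ∧ LReachable c₀ z ∧
    -- y ∨ z = w = 121̲4
    LIsJoin c₀ y z w ∧
    -- x ∧ (y ∨ z) = x
    LIsMeet c₀ x w x ∧
    -- x ∧ y = x ∧ z = f = 211̲31
    LIsMeet c₀ x y f ∧ LIsMeet c₀ x z f ∧
    -- (x ∧ y) ∨ (x ∧ z) = f ∨ f = f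
    LIsJoin c₀ f f f ∧
    -- so (x ∧ y) ∨ (x ∧ z) ≠ x ∧ (y ∨ z)
    f ≠ x ∧
    -- hence the lattice is not distributive
    ¬ (∀ x' y' z' yz' xyz' xy' xz' w' : ℤ → ℕ,
        LReachable c₀ x' → LReachable c₀ y' → LReachable c₀ z' →
        LIsJoin c₀ y' z' yz' → LIsMeet c₀ x' yz' xyz' →
        LIsMeet c₀ x' y' xy' → LIsMeet c₀ x' z' xz' →
        LIsJoin c₀ xy' xz' w' → xyz' = w') := by
  have legal_x : LLegal c₀ (originFiring 2 1 0) := by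
    subst hc₀
    simp [originFiring, List.replicate, LLegal, lfire]
  have legal_y : LLegal c₀ (originFiring 2 0 1) := by
    subst hc₀
    simp [originFiring, List.replicate, LLegal, lfire]
  have legal_z : LLegal c₀ (originFiring 1 1 1) := by
    subst hc₀
    simp [originFiring, List.replicate, LLegal, lfire]
  have legal_w : LLegal c₀ (originFiring 1 0 0) := by
    subst hc₀
    simp [originFiring, List.replicate, LLegal, lfire]
  have legal_f : LLegal c₀ (originFiring 2 1 1) := by
    subst hc₀
    simp [originFiring, List.replicate, LLegal, lfire]
  have eval : ∀ (s : List ℤ) (v : ℤ → ℕ), LLegal c₀ s →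
      (∀ i, v i + 2 * s.count i = c₀ i + s.count (i - 1) + s.count (i + 1)) →
      v = lapply c₀ s := by
    intro s v hs h
    funext i
    have h₁ := h i
    have h₂ := lapply_add_two_mul_count hs i
    omega
  have eval_x : x = lapply c₀ (originFiring 2 1 0) := by
    refine eval _ _ legal_x fun i => ?_
    simp only [hx, hc₀, count_originFiring]
    grind
  have eval_y : y = lapply c₀ (originFiring 2 0 1) := by
    refine eval _ _ legal_y fun i => ?_
    simp only [hy, hc₀, count_originFiring]
    grind
  have eval_z : z = lapply c₀ (originFiring 1 1 1) := by
    refine eval _ _ legal_z fun i => ?_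
    simp only [hz, hc₀, count_originFiring]
    grind
  have eval_w : w = lapply c₀ (originFiring 1 0 0) := by
    refine eval _ _ legal_w fun i => ?_
    simp only [hw, hc₀, count_originFiring]
    grind
  have eval_f : f = lapply c₀ (originFiring 2 1 1) := by
    refine eval _ _ legal_f fun i => ?_
    simp only [hf, hc₀, count_originFiring]
    grind
  have reach_x : LReachable c₀ x := ⟨_, legal_x, eval_x.symm⟩
  have reach_y : LReachable c₀ y := ⟨_, legal_y, eval_y.symm⟩
  have reach_z : LReachable c₀ z := ⟨_, legal_z, eval_z.symm⟩
  have f_ne_x : f ≠ x := by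
    intro h
    have := congrFun h 0
    simp [hf, hx] at this
  have join_yz : LIsJoin c₀ y z w := by
    rw [eval_y, eval_z, eval_w]
    refine lIsJoin_lapply legal_y legal_z legal_w (fun k => ?_) (fun k => ?_) ?_
    · simp only [count_originFiring]
      split_ifs <;> omega
    · simp only [count_originFiring]
      split_ifs <;> omega
    · -- `u` fires the origin at most four times: a fifth firing would need `8 + 1 ≥ 10` chips.
      intro u hu huy huz k
      have h₀ := lapply_add_two_mul_count hu 0
      have hleft := huz (-1)
      have hright := huy 1
      have hy := huy k
      have hz := huz k
      simp only [hc₀, count_originFiring] at h₀ hleft hright hy hz ⊢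
      norm_num at h₀ hleft hright
      by_cases hk : k = 0
      · subst hk
        simp only [if_true]
        omega
      · simp only [if_neg hk] at hy hz ⊢
        split_ifs at hy hz ⊢ <;> omega
  have meet_xw : LIsMeet c₀ x w x := by
    rw [eval_x, eval_w]
    refine lIsMeet_lapply legal_x legal_w legal_x fun k => ?_
    simp only [count_originFiring]
    split_ifs <;> omega
  have meet_xy : LIsMeet c₀ x y f := by
    rw [eval_x, eval_y, eval_f]
    refine lIsMeet_lapply legal_x legal_y legal_f fun k => ?_
    simp only [count_originFiring]
    split_ifs <;> omega
  have meet_xz : LIsMeet c₀ x z f := by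
    rw [eval_x, eval_z, eval_f]
    refine lIsMeet_lapply legal_x legal_z legal_f fun k => ?_
    simp only [count_originFiring]
    split_ifs <;> omega
  have join_ff : LIsJoin c₀ f f f := by
    rw [eval_f]
    exact lIsJoin_lapply legal_f legal_f legal_f (fun _ => le_rfl) (fun _ => le_rfl)
      fun _ _ h _ => h
  exact ⟨fun a b ha hb => ⟨exists_lIsJoin ha hb, exists_lIsMeet ha hb⟩, reach_x, reach_y, reach_z,
    join_yz, meet_xw, meet_xy, meet_xz, join_ff, f_ne_x, fun h => f_ne_x
      (h x y z w x f f f reach_x reach_y reach_z join_yz meet_xw meet_xy meet_xz join_ff).symm⟩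
end
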